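/- arXiv:1407.0559 — 4 statements merged into one kernel-verified Lean document; each statement's English description precedes it below -/
import Mathlib

section
/- Let R be a commutative Noetherian ring, n a non-negative integer, M a finitely generated R-module, N an arbitrary R-module, and t a non-negative integer such that Ext_R^i(M, N) is in dimension < n for all i ≤ t. Then for any finitely generated R-module L with Supp(L) ⊆ Supp(M), the module Ext_R^i(L, N) is in dimension < n for all i ≤ t. -/
open CategoryTheory

noncomputable section

/-- An `R`-module `M` is *in dimension `< n`* if there exists a finitely generated
submodule `N ⊆ M` such that `dim Supp (M/N) < n`. -/
def InDimLT (R : Type) [CommRing R] (M : Type) [AddCommGroup M] [Module R M] (n : ℕ) : Prop :=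
  ∃ N : Submodule R M, N.FG ∧ Order.krullDim (Module.support R (M ⧸ N)) < (n : WithBot ℕ∞)

/-- The `i`-th local cohomology module of `M` with support in the ideal `a`. -/
def locCoh (R : Type) [CommRing R] (a : Ideal R) (i : ℕ)
    (M : Type) [AddCommGroup M] [Module R M] : ModuleCat R :=
  (localCohomology a i).obj (ModuleCat.of R M)

/-- The finiteness dimension `f_a(M)`:  the least `i` such that `H^i_a(M)` is not
finitely generated (`∞` if there is no such `i`). -/
def finDim (R : Type) [CommRing R] (a : Ideal R)
    (M : Type) [AddCommGroup M] [Module R M] : ℕ∞ :=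
  sInf (Nat.cast '' {i : ℕ | ¬ Module.Finite R ↥(locCoh R a i M)})

/-- The `n`-th finiteness dimension `f_a^n(M)`. -/
def finDimN (R : Type) [CommRing R] (a : Ideal R) (n : ℕ)
    (M : Type) [AddCommGroup M] [Module R M] : ℕ∞ :=
  sInf {d : ℕ∞ | ∃ p : PrimeSpectrum R,
    p ∈ Module.support R (M ⧸ (a • ⊤ : Submodule R M)) ∧
    (n : WithBot ℕ∞) ≤ ringKrullDim (R ⧸ p.asIdeal) ∧
    d = finDim (Localization.AtPrime p.asIdeal)
      (a.map (algebraMap R (Localization.AtPrime p.asIdeal)))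
      (LocalizedModule p.asIdeal.primeCompl M)}

/-- `h_a^n(M)`: the least `i` such that `H^i_a(M)` is not in dimension `< n`. -/
def hDimN (R : Type) [CommRing R] (a : Ideal R) (n : ℕ)
    (M : Type) [AddCommGroup M] [Module R M] : ℕ∞ :=
  sInf (Nat.cast '' {i : ℕ | ¬ InDimLT R ↥(locCoh R a i M) n})

namespace CategoryTheory.ProjectiveResolution

open CochainComplex HomComplex

lemma extMk_eq_zero_iff_zero {C : Type*} [Category* C] [Abelian C] [HasExt.{0} C] {X Y : C}
    (P : ProjectiveResolution X) (f : P.complex.X 0 ⟶ Y) (hf : P.complex.d 1 0 ≫ f = 0) :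
    P.extMk f 1 rfl hf = 0 ↔ f = 0 := by
  simp only [← P.extEquivCohomologyClass.apply_eq_iff_eq,
    extEquivCohomologyClass_extMk, extEquivCohomologyClass_zero,
    CohomologyClass.mk_eq_zero_iff]
  have hd : P.cochainComplex.d (-(0 : ℕ)) 1 = 0 :=
    (P.complex.isZero_extend_X ComplexShape.embeddingDownNat 1
      (fun i h ↦ by change -(i : ℤ) = 1 at h; lia)).eq_of_tgt _ _
  rw [Cocycle.toSingleMk_mem_coboundaries_iff _ _ _ _ _ 1 (by lia), hd]
  simp only [Limits.zero_comp, exists_const]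
  exact eq_comm.trans (Preadditive.IsIso.comp_left_eq_zero _ _)

variable {R : Type} [CommRing R] {X : ModuleCat.{0} R} (P : ProjectiveResolution X)
  (Y : ModuleCat.{0} R) (n : ℕ)

/-- The linear map sending a cocycle of `Hom(P, Y)` to its class in `Abelian.Ext`. -/
def extClassLinearMap :
    LinearMap.ker ((P.complex.linearYonedaObj R Y).sc'
      ((ComplexShape.up ℕ).prev n) n (n + 1)).g.hom →ₗ[R] Abelian.Ext X Y n where
  toFun f := P.extMk f.1 (n + 1) rfl f.2
  map_add' f g := (P.add_extMk _ _ _ _ _ _).symm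
  map_smul' r f := by
    refine Eq.trans ?_ ((Abelian.Ext.smul_eq_comp_mk₀ _ r).trans
      (P.extMk_comp_mk₀ f.1 (n + 1) rfl f.2 (r • 𝟙 Y))).symm
    congr 1

lemma extClassLinearMap_surjective : Function.Surjective (P.extClassLinearMap Y n) := by
  intro α
  obtain ⟨f, hf, rfl⟩ := P.extMk_surjective α (n + 1) rfl
  exact ⟨⟨f, hf⟩, rfl⟩

lemma ker_extClassLinearMap : LinearMap.ker (P.extClassLinearMap Y n) =
    LinearMap.range ((P.complex.linearYonedaObj R Y).sc'
      ((ComplexShape.up ℕ).prev n) n (n + 1)).moduleCatToCycles := by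
  ext ⟨f, hf⟩
  simp only [LinearMap.mem_ker, LinearMap.mem_range]
  cases n with
  | zero =>
    refine (P.extMk_eq_zero_iff_zero f hf).trans ?_
    have h0 (g) : ((P.complex.linearYonedaObj R Y).sc'
        ((ComplexShape.up ℕ).prev 0) 0 (0 + 1)).moduleCatToCycles g = 0 := by
      ext1
      exact congr($((P.complex.linearYonedaObj R Y).shape _ 0 (by simp)) g)
    exact ⟨fun h ↦ ⟨0, (h0 0).trans (Subtype.ext h.symm)⟩,
      fun ⟨g, hg⟩ ↦ congrArg Subtype.val ((h0 g).symm.trans hg) |>.symm⟩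
  | succ n =>
    refine (P.extMk_eq_zero_iff f _ rfl hf n rfl).trans ?_
    rw [CochainComplex.prev_nat_succ]
    exact ⟨fun ⟨g, hg⟩ ↦ ⟨g, Subtype.ext hg⟩, fun ⟨g, hg⟩ ↦ ⟨g, congrArg Subtype.val hg⟩⟩

/-- The derived-functor `Ext` agrees with `Abelian.Ext`. -/
def extLinearEquiv :
    ((_root_.Ext R (ModuleCat R) n).obj (Opposite.op X)).obj Y ≃ₗ[R] Abelian.Ext X Y n :=
  haveI e := Submodule.quotEquivOfEq _ _ (P.ker_extClassLinearMap Y n).symm ≪≫ₗ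
    LinearMap.quotKerEquivOfSurjective _ (P.extClassLinearMap_surjective Y n)
  (P.isoExt n Y ≪≫ (P.complex.linearYonedaObj R Y).homologyIsoSc' _ n (n + 1) rfl (by simp) ≪≫
    ShortComplex.moduleCatHomologyIso _).toLinearEquiv ≪≫ₗ e

end CategoryTheory.ProjectiveResolution

section Hom

open TensorProduct

/-- A finite module over a Noetherian ring maps nontrivially to `R ⧸ p` for each `p` in its
support. -/
lemma Module.exists_linearMap_quotient_ne_zero {R : Type*} [CommRing R] [IsNoetherianRing R]
    (M : Type*) [AddCommGroup M] [Module R M] [Module.Finite R M] {p : PrimeSpectrum R}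
    (hp : p ∈ Module.support R M) : ∃ f : M →ₗ[R] R ⧸ p.asIdeal, f ≠ 0 := by
  let k := p.asIdeal.ResidueField
  have : Nontrivial (k ⊗[R] M) :=
    (Module.mem_support_iff_nontrivial_residueField_tensorProduct p).mp hp
  obtain ⟨φ, hφ⟩ := exists_ne (0 : Module.Dual k (k ⊗[R] M))
  let g : M →ₗ[R] k := φ.restrictScalars R ∘ₗ TensorProduct.mk R k M 1
  have hg : g ≠ 0 := by
    intro h
    apply hφ
    ext m
    exact congr($h m)
  have := Module.finitePresentation_of_finite R M
  have : IsLocalizedModule p.asIdeal.primeCompl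
      ((Algebra.linearMap (R ⧸ p.asIdeal) k).restrictScalars R) := by
    refine ⟨fun s ↦ ?_, fun x ↦ ?_, fun {x y} h ↦ ⟨1, ?_⟩⟩
    · have hs : algebraMap R k s ≠ 0 := fun h ↦ s.2 (Ideal.algebraMap_residueField_eq_zero.mp h)
      rw [Module.End.isUnit_iff]
      refine ⟨fun x y h ↦ ?_, fun y ↦ ⟨(algebraMap R k s)⁻¹ * y, ?_⟩⟩
      · simpa [Algebra.smul_def, hs] using h
      · simp [Algebra.smul_def, mul_inv_cancel_left₀ hs]
    · obtain ⟨⟨a, b⟩, h⟩ := IsLocalization.surj (nonZeroDivisors (R ⧸ p.asIdeal)) x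
      obtain ⟨b, hb⟩ := b
      obtain ⟨b, rfl⟩ := Ideal.Quotient.mk_surjective b
      refine ⟨⟨a, b, fun h ↦ nonZeroDivisors.ne_zero hb (Ideal.Quotient.eq_zero_iff_mem.mpr h)⟩, ?_⟩
      exact (Algebra.smul_def b x).trans ((mul_comm _ _).trans h)
    · simpa using p.asIdeal.injective_algebraMap_quotient_residueField h
  obtain ⟨f, s, hf⟩ := Module.FinitePresentation.exists_lift_of_isLocalizedModule
    p.asIdeal.primeCompl ((Algebra.linearMap (R ⧸ p.asIdeal) k).restrictScalars R) g
  refine ⟨f, ?_⟩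
  rintro rfl
  apply hg
  ext m
  have := congr($hf m)
  have hs : algebraMap R k s ≠ 0 := fun h ↦ s.2 (Ideal.algebraMap_residueField_eq_zero.mp h)
  simpa [Submonoid.smul_def, Algebra.smul_def, hs] using this

end Hom

lemma Order.krullDim_le_max_of_subset_union {α : Type*} [Preorder α] {S T U : Set α}
    (hS : IsUpperSet S) (hT : IsUpperSet T) (h : U ⊆ S ∪ T) :
    Order.krullDim U ≤ max (Order.krullDim S) (Order.krullDim T) := by
  have key (V : Set α) (hV : IsUpperSet V) (s : LTSeries U) (hs : s.head.1 ∈ V) :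
      (s.length : WithBot ℕ∞) ≤ Order.krullDim V :=
    LTSeries.length_le_krullDim (α := V) ⟨s.length, fun i ↦ ⟨(s i).1, hV (s.head_le i) hs⟩, s.step⟩
  refine iSup_le fun s ↦ ?_
  rcases h s.head.2 with hs | hs
  · exact (key S hS s hs).trans (le_max_left _ _)
  · exact (key T hT s hs).trans (le_max_right _ _)

section InDimLT

variable {R : Type} [CommRing R] {n : ℕ} {A B C : Type} [AddCommGroup A] [Module R A]
  [AddCommGroup B] [Module R B] [AddCommGroup C] [Module R C]

lemma Module.notMem_support_quotient_iff {M : Type*} [AddCommGroup M] [Module R M]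
    {N : Submodule R M} {p : PrimeSpectrum R} :
    p ∉ Module.support R (M ⧸ N) ↔ ∀ m : M, ∃ r ∉ p.asIdeal, r • m ∈ N := by
  rw [Module.notMem_support_iff', N.mkQ_surjective.forall]
  simp [← Submodule.Quotient.mk_smul]

lemma InDimLT.of_subsingleton [Subsingleton A] : InDimLT R A n := by
  refine ⟨⊥, Submodule.fg_bot, ?_⟩
  have := Module.support_eq_empty (R := R) (M := A ⧸ (⊥ : Submodule R A))
  rw [this, Order.krullDim_eq_bot]
  exact WithBot.bot_lt_coe _

/-- The modules in dimension `< n` over a Noetherian ring form a Serre class. -/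
lemma InDimLT.of_exact [IsNoetherianRing R] {f : A →ₗ[R] B} {g : B →ₗ[R] C}
    (h : Function.Exact f g) (hA : InDimLT R A n) (hC : InDimLT R C n) : InDimLT R B n := by
  obtain ⟨A₀, hA₀, hA⟩ := hA
  obtain ⟨C₀, hC₀, hC⟩ := hC
  have : IsNoetherian R C₀ := isNoetherian_of_fg_of_noetherian _ hC₀
  have hgC : (LinearMap.range g ⊓ C₀).FG :=
    isNoetherian_submodule.mp this _ inf_le_right
  obtain ⟨B₀, hB₀, hgB⟩ : ∃ B₀ : Submodule R B, B₀.FG ∧ B₀.map g = LinearMap.range g ⊓ C₀ := by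
    classical
    obtain ⟨s, hs⟩ := hgC
    obtain ⟨u, -, rfl⟩ := Finset.subset_set_image_iff (s := Set.univ) (f := g).mp fun c hc ↦ by
      obtain ⟨b, hb⟩ := (hs.le (Submodule.subset_span hc)).1
      exact ⟨b, trivial, hb⟩
    exact ⟨_, ⟨u, rfl⟩, by rw [Submodule.map_span, ← hs, Finset.coe_image]⟩
  refine ⟨A₀.map f ⊔ B₀, (hA₀.map f).sup hB₀, lt_of_le_of_lt
    (Order.krullDim_le_max_of_subset_union (fun _ _ ↦ Module.mem_support_mono)
      (fun _ _ ↦ Module.mem_support_mono) fun p ↦ ?_) (max_lt hA hC)⟩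
  contrapose
  simp only [Set.mem_union, not_or, Module.notMem_support_quotient_iff]
  rintro ⟨hpA, hpC⟩ b
  obtain ⟨r, hr, hrb⟩ := hpC (g b)
  have : r • g b ∈ B₀.map g := hgB ▸ ⟨⟨r • b, map_smul _ _ _⟩, hrb⟩
  obtain ⟨b₀, hb₀, hb⟩ := this
  obtain ⟨a, ha⟩ := (h (r • b - b₀)).mp (by simp [hb])
  obtain ⟨s, hs, hsa⟩ := hpA a
  refine ⟨s * r, p.asIdeal.primeCompl.mul_mem hs hr, ?_⟩
  have : (s * r) • b = f (s • a) + s • b₀ := by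
    rw [map_smul, ha, smul_sub, mul_smul, sub_add_cancel]
  rw [this]
  exact Submodule.add_mem_sup ⟨_, hsa, rfl⟩ (B₀.smul_mem s hb₀)

lemma InDimLT.of_linearEquiv [IsNoetherianRing R] (e : A ≃ₗ[R] B) (hA : InDimLT R A n) :
    InDimLT R B n :=
  .of_exact (f := e.toLinearMap) (g := (0 : B →ₗ[R] PUnit))
    ((e.toLinearMap.exact_zero_iff_surjective _).mpr e.surjective) hA .of_subsingleton

end InDimLT

section ExtInDimLT

open Abelian

variable {R : Type} [CommRing R] {n i : ℕ} {Y : ModuleCat.{0} R}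
  {A B C : Type} [AddCommGroup A] [Module R A]
  [AddCommGroup B] [Module R B] [AddCommGroup C] [Module R C]

variable (n i Y A) in
/-- The module `Ext^i(A, Y)` is in dimension `< n`. -/
abbrev ExtInDimLT : Prop := InDimLT R (Abelian.Ext (ModuleCat.of R A) Y i) n

namespace ExtInDimLT

lemma of_subsingleton [Subsingleton A] : ExtInDimLT n i Y A := by
  have h : (𝟙 (ModuleCat.of R A)) = 0 := by
    ext a
    exact Subsingleton.elim (α := A) _ _
  have : Subsingleton (Abelian.Ext (ModuleCat.of R A) Y i) := by
    refine subsingleton_of_forall_eq 0 fun x ↦ ?_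
    rw [← Abelian.Ext.mk₀_id_comp x, h, Abelian.Ext.mk₀_zero, Abelian.Ext.zero_comp]
  exact InDimLT.of_subsingleton

section
variable {f : A →ₗ[R] B} {g : B →ₗ[R] C} (hf : Function.Injective f)
  (hg : Function.Surjective g) (h : Function.Exact f g)
include hf hg h

lemma shortExact : (ModuleCat.shortComplexOfCompEqZero f g h.linearMap_comp_eq_zero).ShortExact :=
  ModuleCat.shortComplex_shortExact _ h hf hg

variable [IsNoetherianRing R]

lemma of_shortExact_middle (hA : ExtInDimLT n i Y A) (hC : ExtInDimLT n i Y C) :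
    ExtInDimLT n i Y B := by
  refine InDimLT.of_exact
    (f := (Ext.mk₀ (ModuleCat.ofHom g)).precompOfLinear R Y (zero_add i))
    (g := (Ext.mk₀ (ModuleCat.ofHom f)).precompOfLinear R Y (zero_add i)) ?_ hC hA
  exact (ShortComplex.ab_exact_iff_function_exact _).mp
    (Ext.contravariant_sequence_exact₂' (shortExact hf hg h) Y i)

lemma of_shortExact_right (hA : ∀ j, 1 + j = i → ExtInDimLT n j Y A) (hB : ExtInDimLT n i Y B) :
    ExtInDimLT n i Y C := by
  cases i with
  | zero =>
    refine InDimLT.of_exact (f := (0 : PUnit →ₗ[R] _))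
      (g := (Ext.mk₀ (ModuleCat.ofHom g)).precompOfLinear R Y (zero_add 0))
      ?_ .of_subsingleton hB
    rw [LinearMap.exact_zero_iff_injective]
    have : Epi (ModuleCat.ofHom g) := (ModuleCat.epi_iff_surjective _).mpr hg
    exact Ext.precomp_mk₀_injective_of_epi Y (ModuleCat.ofHom g)
  | succ j =>
    refine InDimLT.of_exact
      (f := (shortExact hf hg h).extClass.precompOfLinear R Y (add_comm 1 j))
      (g := (Ext.mk₀ (ModuleCat.ofHom g)).precompOfLinear R Y (zero_add (j + 1)))
      ?_ (hA j (add_comm 1 j)) hB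
    exact (ShortComplex.ab_exact_iff_function_exact _).mp
      (Ext.contravariant_sequence_exact₃' (shortExact hf hg h) Y j (j + 1) (add_comm 1 j))

end

variable [IsNoetherianRing R]

lemma of_linearEquiv (e : A ≃ₗ[R] B) (hA : ExtInDimLT n i Y A) : ExtInDimLT n i Y B :=
  of_shortExact_middle (g := (0 : B →ₗ[R] PUnit)) e.injective
    (Function.surjective_to_subsingleton _)
    ((e.toLinearMap.exact_zero_iff_surjective _).mpr e.surjective) hA of_subsingleton

lemma of_forall_mem_support [Module.Finite R A]
    (hA : ∀ p ∈ Module.support R A, ExtInDimLT n i Y (R ⧸ p.asIdeal)) : ExtInDimLT n i Y A := by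
  revert hA
  induction ‹Module.Finite R A›
    using IsNoetherianRing.induction_on_isQuotientEquivQuotientPrime R with
  | subsingleton => exact fun _ ↦ of_subsingleton
  | quotient N p e =>
    refine fun h ↦ of_linearEquiv e.symm (h p ?_)
    rw [e.support_eq, Module.support_of_algebra]
    simp
  | exact A B C f g hf hg h ihA ihC =>
    rw [Module.support_of_exact h hf hg]
    exact fun H ↦ of_shortExact_middle hf hg h (ihA fun p hp ↦ H p (.inl hp))
      (ihC fun p hp ↦ H p (.inr hp))

variable {M : Type} [AddCommGroup M] [Module R M] [Module.Finite R M]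

/-- If `p ∈ Supp M` and `Ext^i(Q, Y)` is in dimension `< n` for every quotient `Q` of `M`,
then so is `Ext^i(R ⧸ p, Y)`: by Noetherian induction on `p`, using a nonzero map `M → R ⧸ p`. -/
lemma quotient_prime {p : PrimeSpectrum R} (hp : p ∈ Module.support R M)
    (hM : ∀ (Q : Type) [AddCommGroup Q] [Module R Q] (f : M →ₗ[R] Q),
      Function.Surjective f → ExtInDimLT n i Y Q) : ExtInDimLT n i Y (R ⧸ p.asIdeal) := by
  induction p using (InvImage.wf PrimeSpectrum.asIdeal
    (wellFounded_gt (α := Ideal R))).induction with | _ p ih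
  obtain ⟨f, hf⟩ := Module.exists_linearMap_quotient_ne_zero M hp
  refine of_shortExact_middle (LinearMap.range f).subtype_injective
    (LinearMap.range f).mkQ_surjective
    (LinearMap.exact_subtype_mkQ _) (hM _ f.rangeRestrict f.surjective_rangeRestrict)
    (of_forall_mem_support fun q hq ↦ ?_)
  have hpq : p ≤ q := by
    refine le_trans (a := p.asIdeal) (fun a ha ↦ ?_) (Module.annihilator_le_of_mem_support hq)
    rw [Module.mem_annihilator, (Submodule.mkQ_surjective _).forall]
    intro x
    rw [← map_smul, Algebra.smul_def, Ideal.Quotient.algebraMap_eq,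
      Ideal.Quotient.eq_zero_iff_mem.mpr ha, zero_mul, map_zero]
  refine ih q (lt_of_le_of_ne hpq fun h ↦ ?_) (Module.mem_support_mono hpq hp)
  obtain rfl := PrimeSpectrum.ext h
  obtain ⟨m, hm⟩ := DFunLike.ne_iff.mp hf
  obtain ⟨a, ha⟩ := Ideal.Quotient.mk_surjective (f m)
  refine Module.notMem_support_quotient_iff.mpr (fun x ↦ ⟨a, fun h ↦ hm ?_, ?_⟩) hq
  · rw [← ha, Ideal.Quotient.eq_zero_iff_mem.mpr h, LinearMap.zero_apply]
  · obtain ⟨x, rfl⟩ := Ideal.Quotient.mk_surjective x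
    exact ⟨x • m, by rw [map_smul, ← ha, Algebra.smul_def, Algebra.smul_def, mul_comm]; rfl⟩

theorem of_support_subset {t : ℕ} (hM : ∀ i ≤ t, ExtInDimLT n i Y M)
    (L : Type) [AddCommGroup L] [Module R L] [Module.Finite R L]
    (hL : Module.support R L ⊆ Module.support R M) (hi : i ≤ t) : ExtInDimLT n i Y L := by
  induction i using Nat.strong_induction_on generalizing L with | _ i ih
  refine of_forall_mem_support fun p hp ↦ quotient_prime (hL hp) fun Q _ _ f hf ↦ ?_
  refine of_shortExact_right (LinearMap.ker f).subtype_injective hf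
    (LinearMap.exact_subtype_ker_map f)
    (fun j hj ↦ ih j (by lia) _ ?_ (by lia)) (hM i hi)
  exact Module.support_subset_of_injective _ (LinearMap.ker f).subtype_injective

end ExtInDimLT

end ExtInDimLT

/-- If `Ext_R^i(M, N)` is in dimension `< n` for all `i ≤ t`, then for every finitely
generated `L` with `Supp L ⊆ Supp M`, `Ext_R^i(L, N)` is in dimension `< n` for all `i ≤ t`. -/
theorem inDimLT_ext_of_support_subset (R : Type) [CommRing R] [IsNoetherianRing R] (n : ℕ)
    (M : Type) [AddCommGroup M] [Module R M] [Module.Finite R M]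
    (N : Type) [AddCommGroup N] [Module R N] (t : ℕ)
    (hMN : ∀ i ≤ t, InDimLT R
      ↥(((Ext R (ModuleCat R) i).obj (Opposite.op (ModuleCat.of R M))).obj (ModuleCat.of R N)) n)
    (L : Type) [AddCommGroup L] [Module R L] [Module.Finite R L]
    (hL : Module.support R L ⊆ Module.support R M) :
    ∀ i ≤ t, InDimLT R
      ↥(((Ext R (ModuleCat R) i).obj (Opposite.op (ModuleCat.of R L))).obj (ModuleCat.of R N))
      n := by
  intro i hi
  let e (K : Type) [AddCommGroup K] [Module R K] (j : ℕ) :=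
    (projectiveResolution (ModuleCat.of R K)).extLinearEquiv (ModuleCat.of R N) j
  exact .of_linearEquiv (e L i).symm
    (ExtInDimLT.of_support_subset (fun j hj ↦ (hMN j hj).of_linearEquiv (e M j)) L hL hi)
end
end

section
/- Let R be a commutative Noetherian ring, a an ideal of R, and t, n non-negative integers. For any R-module M, the following are equivalent: (i) Ext_R^i(R/a, M) is in dimension < n for all i ≤ t; (ii) for every ideal b of R with b ⊇ a, Ext_R^i(R/b, M) is in dimension < n for all i ≤ t; (iii) for every finitely generated R-module N with Supp(N) ⊆ V(a), Ext_R^i(N, M) is in dimension < n for all i ≤ t; (iv) for every minimal prime ideal p over a, Ext_R^i(R/p, M) is in dimension < n for all i ≤ t. -/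
open CategoryTheory

noncomputable section

lemma Order.krullDim_le_max_of_subset_union_s15 {α : Type*} [Preorder α] {A B C : Set α}
    (hA : IsUpperSet A) (hB : IsUpperSet B) (hC : C ⊆ A ∪ B) :
    Order.krullDim C ≤ max (Order.krullDim A) (Order.krullDim B) := by
  have key (D : Set α) (hD : IsUpperSet D) (s : LTSeries C) (h : (s.head : α) ∈ D) :
      (s.length : WithBot ℕ∞) ≤ Order.krullDim D :=
    LTSeries.length_le_krullDim
      { length := s.length
        toFun := fun i ↦ ⟨s i, hD (Subtype.coe_le_coe.mpr (s.head_le i)) h⟩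
        step := fun i ↦ s.step i }
  refine iSup_le fun s ↦ ?_
  rcases hC s.head.2 with h | h
  · exact (key A hA s h).trans (le_max_left _ _)
  · exact (key B hB s h).trans (le_max_right _ _)

namespace Module

lemma isUpperSet_support (R M : Type*) [CommRing R] [AddCommGroup M] [Module R M] :
    IsUpperSet (Module.support R M) :=
  fun _ _ h hp ↦ Module.mem_support_mono h hp

lemma support_subset_of_function_exact {R M M' M'' : Type*} [CommRing R] [AddCommGroup M]
    [Module R M] [AddCommGroup M'] [Module R M'] [AddCommGroup M''] [Module R M'']
    {f : M' →ₗ[R] M} {g : M →ₗ[R] M''} (h : Function.Exact f g) :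
    Module.support R M ⊆ Module.support R M' ∪ Module.support R M'' := by
  have h' : Function.Exact (LinearMap.range f).subtype g.rangeRestrict := by
    intro x
    simpa [Subtype.ext_iff] using h x
  rw [Module.support_of_exact h' (Submodule.subtype_injective _) g.surjective_rangeRestrict]
  exact Set.union_subset_union
    (Module.support_subset_of_surjective f.rangeRestrict f.surjective_rangeRestrict)
    (Module.support_subset_of_injective _ (Submodule.subtype_injective _))

lemma support_quotient_ideal {R : Type*} [CommRing R] (I : Ideal R) :
    Module.support R (R ⧸ I) = PrimeSpectrum.zeroLocus I := by
  rw [Module.support_eq_zeroLocus, Ideal.annihilator_quotient]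

end Module

namespace InDimLT

variable {R : Type} [CommRing R] {M M' M'' : Type} [AddCommGroup M] [Module R M]
  [AddCommGroup M'] [Module R M'] [AddCommGroup M''] [Module R M''] {n : ℕ}

lemma krullDim_lt_of_subset {A B : Set (PrimeSpectrum R)} (h : A ⊆ B)
    (hB : Order.krullDim B < (n : WithBot ℕ∞)) : Order.krullDim A < (n : WithBot ℕ∞) :=
  (Order.krullDim_le_of_strictMono (Set.inclusion h) fun _ _ hab ↦ hab).trans_lt hB

lemma of_surjective (f : M →ₗ[R] M') (hf : Function.Surjective f) (h : InDimLT R M n) :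
    InDimLT R M' n := by
  obtain ⟨N, hN, hdim⟩ := h
  refine ⟨N.map f, hN.map f, krullDim_lt_of_subset (Module.support_subset_of_surjective
    (N.mapQ (N.map f) f (Submodule.le_comap_map f N)) fun x ↦ ?_) hdim⟩
  obtain ⟨x, rfl⟩ := Submodule.mkQ_surjective _ x
  obtain ⟨x, rfl⟩ := hf x
  exact ⟨N.mkQ x, rfl⟩

lemma of_injective [IsNoetherianRing R] (f : M →ₗ[R] M') (hf : Function.Injective f)
    (h : InDimLT R M' n) : InDimLT R M n := by
  obtain ⟨N, hN, hdim⟩ := h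
  have : IsNoetherian R N := isNoetherian_of_fg_of_noetherian N hN
  have hfg : (N.comap f).FG := by
    rw [← Module.Finite.iff_fg]
    refine Module.Finite.of_injective (f.restrict (p := N.comap f) (q := N) fun _ hx ↦ hx) ?_
    intro x y hxy
    exact Subtype.ext (hf (congr_arg Subtype.val hxy))
  refine ⟨N.comap f, hfg, krullDim_lt_of_subset (Module.support_subset_of_injective
    ((N.comap f).mapQ N f le_rfl) ?_) hdim⟩
  rw [← LinearMap.ker_eq_bot, Submodule.ker_mapQ]
  simp [Submodule.mkQ_map_self]

lemma of_subsingleton_s15 [Subsingleton M] : InDimLT R M n := by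
  refine ⟨⊥, Submodule.fg_bot, ?_⟩
  have : IsEmpty (Module.support R (M ⧸ (⊥ : Submodule R M))) := by
    rw [Set.isEmpty_coe_sort, Module.support_eq_empty_iff]
    infer_instance
  rw [Order.krullDim_eq_bot]
  exact WithBot.bot_lt_coe _

lemma of_exact_of_surjective {f : M' →ₗ[R] M} {g : M →ₗ[R] M''} (hfg : Function.Exact f g)
    (hg : Function.Surjective g) (h' : InDimLT R M' n) (h'' : InDimLT R M'' n) :
    InDimLT R M n := by
  obtain ⟨N', hN', hdim'⟩ := h'
  obtain ⟨_, ⟨S, rfl⟩, hdim''⟩ := h''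
  obtain ⟨L, hL, hLS⟩ : ∃ L : Submodule R M, L.FG ∧ L.map g = Submodule.span R S := by
    refine ⟨Submodule.span R (Function.surjInv hg '' S),
      Submodule.fg_span (S.finite_toSet.image _), ?_⟩
    rw [Submodule.map_span, ← Set.image_comp, (Function.rightInverse_surjInv hg).comp_eq_id,
      Set.image_id]
  rw [← hLS] at hdim''
  have hf : N' ≤ (L ⊔ N'.map f).comap f :=
    Submodule.map_le_iff_le_comap.mp le_sup_right
  have hg' : L ⊔ N'.map f ≤ (L.map g).comap g := by
    refine sup_le (Submodule.le_comap_map g L) ?_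
    rintro _ ⟨x, -, rfl⟩
    rw [Submodule.mem_comap, hfg.apply_apply_eq_zero]
    exact zero_mem _
  have hex : Function.Exact (N'.mapQ _ f hf) (Submodule.mapQ _ (L.map g) g hg') := by
    rw [LinearMap.exact_iff, Submodule.ker_mapQ]
    refine le_antisymm ?_ ?_
    · rintro _ ⟨m, ⟨l, hl, hlm⟩, rfl⟩
      obtain ⟨x, hx⟩ := (hfg (m - l)).mp (by rw [map_sub, hlm, sub_self])
      refine ⟨N'.mkQ x, ?_⟩
      simp only [Submodule.mkQ_apply, Submodule.mapQ_apply, hx]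
      rw [Submodule.Quotient.eq]
      exact Submodule.mem_sup_left (by simpa using hl)
    · rintro _ ⟨x, rfl⟩
      obtain ⟨x, rfl⟩ := Submodule.mkQ_surjective _ x
      refine ⟨f x, ?_, rfl⟩
      rw [SetLike.mem_coe, Submodule.mem_comap, hfg.apply_apply_eq_zero]
      exact zero_mem _
  exact ⟨L ⊔ N'.map f, hL.sup (hN'.map f),
    (Order.krullDim_le_max_of_subset_union_s15 (Module.isUpperSet_support _ _)
      (Module.isUpperSet_support _ _) (Module.support_subset_of_function_exact hex)).trans_lt
      (max_lt hdim' hdim'')⟩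

lemma of_exact_s15 [IsNoetherianRing R] {f : M' →ₗ[R] M} {g : M →ₗ[R] M''}
    (hfg : Function.Exact f g) (h' : InDimLT R M' n) (h'' : InDimLT R M'' n) :
    InDimLT R M n := by
  refine of_exact_of_surjective (f := f) (g := g.rangeRestrict) (fun x ↦ ?_)
    g.surjective_rangeRestrict h' (h''.of_injective _ (Submodule.subtype_injective _))
  simpa [Subtype.ext_iff] using hfg x

end InDimLT

namespace CategoryTheory.ProjectiveResolution

open Abelian CochainComplex HomComplex Limits

section

universe w v u

variable {C : Type u} [Category.{v} C] [Abelian C] [HasExt.{w} C]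
  {X Y : C} (P : ProjectiveResolution X)

lemma extMk_eq_zero_iff_exists_prev {n : ℕ} (f : P.complex.X n ⟶ Y) (m : ℕ) (hm : n + 1 = m)
    (hf : P.complex.d m n ≫ f = 0) :
    P.extMk f m hm hf = 0 ↔
      ∃ g : P.complex.X ((ComplexShape.up ℕ).prev n) ⟶ Y,
        P.complex.d n ((ComplexShape.up ℕ).prev n) ≫ g = f := by
  obtain _ | k := n
  · have hd : P.complex.d 0 ((ComplexShape.up ℕ).prev 0) = 0 :=
      P.complex.shape _ _ (by simp)
    simp only [hd, zero_comp, exists_const]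
    rw [← P.extEquivCohomologyClass.apply_eq_iff_eq, extEquivCohomologyClass_extMk,
      extEquivCohomologyClass_zero, CohomologyClass.mk_eq_zero_iff,
      Cocycle.toSingleMk_mem_coboundaries_iff _ _ _ _ _ 1 (by simp)]
    have hz : P.cochainComplex.d (-((0 : ℕ) : ℤ)) 1 = 0 :=
      (P.cochainComplex.isZero_of_isStrictlyLE 0 1).eq_of_tgt _ _
    simp only [hz, zero_comp, exists_const]
    rw [← cancel_epi (P.cochainComplexXIso (-((0 : ℕ) : ℤ)) 0 rfl).hom, comp_zero]
  · exact P.extMk_eq_zero_iff f m hm hf _ (by simp)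

end

section

universe w v u t

variable {R : Type t} [CommRing R] {C : Type u} [Category.{v} C] [Abelian C] [Linear R C]
  [HasExt.{w} C] {X : C} (P : ProjectiveResolution X)

variable (R) in
/-- The `R`-linear map sending a cocycle of `Hom(P, Y)` to its class in `Ext X Y n`. -/
def extMkLinearMap (Y : C) (n : ℕ) :
    LinearMap.ker ((P.complex.linearYonedaObj R Y).sc n).g.hom →ₗ[R] Abelian.Ext X Y n where
  toFun f := P.extMk (Y := Y) f.1 ((ComplexShape.up ℕ).next n) (by simp) f.2
  map_add' f g := (P.add_extMk (Y := Y) f.1 g.1 _ (by simp) f.2 g.2).symm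
  map_smul' r f := by
    refine Eq.trans ?_ (Ext.smul_eq_comp_mk₀ _ r).symm
    refine Eq.trans ?_ (P.extMk_comp_mk₀ (Y := Y) f.1 _ (by simp) f.2 (r • 𝟙 Y)).symm
    congr 1
    exact ((Linear.comp_smul _ _ _ _ _ _).trans (congrArg (r • ·) (Category.comp_id _))).symm

lemma extMkLinearMap_surjective (Y : C) (n : ℕ) :
    Function.Surjective (P.extMkLinearMap R Y n) := fun α ↦
  let ⟨f, hf, h⟩ := P.extMk_surjective α ((ComplexShape.up ℕ).next n) (by simp)
  ⟨⟨f, hf⟩, h⟩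

lemma ker_extMkLinearMap (Y : C) (n : ℕ) :
    LinearMap.ker (P.extMkLinearMap R Y n) =
      LinearMap.range ((P.complex.linearYonedaObj R Y).sc n).moduleCatToCycles := by
  ext f
  refine (P.extMk_eq_zero_iff_exists_prev (Y := Y) f.1 _ (by simp) f.2).trans ?_
  exact ⟨fun ⟨g, hg⟩ ↦ ⟨g, Subtype.ext hg⟩, fun ⟨g, hg⟩ ↦ ⟨g, congrArg Subtype.val hg⟩⟩

variable (R) in
/-- The homology of `Hom(P, Y)` is `R`-linearly equivalent to `Ext X Y n`. -/
def homologyLinearYonedaObjEquivExt (Y : C) (n : ℕ) :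
    (P.complex.linearYonedaObj R Y).homology n ≃ₗ[R] Abelian.Ext X Y n :=
  ((P.complex.linearYonedaObj R Y).sc n).moduleCatHomologyIso.toLinearEquiv ≪≫ₗ
    Submodule.quotEquivOfEq _ _ (P.ker_extMkLinearMap (R := R) Y n).symm ≪≫ₗ
    (P.extMkLinearMap R Y n).quotKerEquivOfSurjective (P.extMkLinearMap_surjective Y n)

end

end CategoryTheory.ProjectiveResolution

/-- The derived-functor `Ext` agrees `R`-linearly with `Ext` computed in the derived category. -/
def CategoryTheory.extLinearEquivAbelianExt {R C : Type*} [CommRing R] [Category C] [Abelian C]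
    [Linear R C] [EnoughProjectives C] [HasExt C] (X Y : C) (n : ℕ) :
    ((Ext R C n).obj (Opposite.op X)).obj Y ≃ₗ[R] Abelian.Ext X Y n :=
  ((projectiveResolution X).isoExt n Y).toLinearEquiv ≪≫ₗ
    (projectiveResolution X).homologyLinearYonedaObjEquivExt R Y n

namespace InDimLT

open Abelian

variable {R : Type} [CommRing R] {n : ℕ}

lemma abelianExt_of_shortExact [IsNoetherianRing R] {S : ShortComplex (ModuleCat.{0} R)}
    (hS : S.ShortExact) (Y : ModuleCat.{0} R) {i : ℕ} (h₁ : InDimLT R (Abelian.Ext S.X₁ Y i) n)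
    (h₃ : InDimLT R (Abelian.Ext S.X₃ Y i) n) : InDimLT R (Abelian.Ext S.X₂ Y i) n := by
  refine of_exact_s15 (f := (Ext.mk₀ S.g).precompOfLinear R Y (zero_add i))
    (g := (Ext.mk₀ S.f).precompOfLinear R Y (zero_add i)) (fun x ↦ ⟨fun hx ↦ ?_, ?_⟩) h₃ h₁
  · exact Ext.contravariant_sequence_exact₂ hS Y x hx
  · rintro ⟨x, rfl⟩
    simp [← Ext.comp_assoc_of_second_deg_zero]

lemma abelianExt_succ_of_shortExact [IsNoetherianRing R] {S : ShortComplex (ModuleCat.{0} R)}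
    (hS : S.ShortExact) (Y : ModuleCat.{0} R) {i : ℕ} (h₁ : InDimLT R (Abelian.Ext S.X₁ Y i) n)
    (h₂ : InDimLT R (Abelian.Ext S.X₂ Y (i + 1)) n) :
    InDimLT R (Abelian.Ext S.X₃ Y (i + 1)) n := by
  refine of_exact_s15 (f := hS.extClass.precompOfLinear R Y (add_comm 1 i))
    (g := (Ext.mk₀ S.g).precompOfLinear R Y (zero_add (i + 1))) (fun x ↦ ⟨fun hx ↦ ?_, ?_⟩) h₁ h₂
  · exact Ext.contravariant_sequence_exact₃ hS Y x hx (add_comm 1 i)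
  · rintro ⟨x, rfl⟩
    simp

lemma abelianExt_zero_of_epi [IsNoetherianRing R] {X X' : ModuleCat.{0} R} (g : X ⟶ X') [Epi g]
    (Y : ModuleCat.{0} R) (h : InDimLT R (Abelian.Ext X Y 0) n) :
    InDimLT R (Abelian.Ext X' Y 0) n :=
  h.of_injective ((Ext.mk₀ g).precompOfLinear R Y (zero_add 0))
    (Ext.precomp_mk₀_injective_of_epi Y g)

lemma abelianExt_of_iso {X X' : ModuleCat.{0} R} (e : X ≅ X') {Y : ModuleCat.{0} R} {i : ℕ}
    (h : InDimLT R (Abelian.Ext X' Y i) n) : InDimLT R (Abelian.Ext X Y i) n :=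
  h.of_surjective ((Ext.mk₀ e.hom).precompOfLinear R Y (zero_add i)) fun x ↦
    ⟨(Ext.mk₀ e.inv).comp x (zero_add i), by simp⟩

/-- By prime filtrations, it suffices to test the modules `R/q` with `q` prime. -/
lemma abelianExt_of_forall_isPrime [IsNoetherianRing R] {a : Ideal R} {Y : ModuleCat.{0} R} {i : ℕ}
    (h : ∀ q : Ideal R, q.IsPrime → a ≤ q →
      InDimLT R (Abelian.Ext (ModuleCat.of R (R ⧸ q)) Y i) n)
    (N : Type) [AddCommGroup N] [Module R N] [Module.Finite R N]
    (hN : Module.support R N ⊆ PrimeSpectrum.zeroLocus (a : Set R)) :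
    InDimLT R (Abelian.Ext (ModuleCat.of R N) Y i) n := by
  revert hN
  induction ‹Module.Finite R N› using
    IsNoetherianRing.induction_on_isQuotientEquivQuotientPrime R with
  | subsingleton N =>
    intro _
    have : Subsingleton (Abelian.Ext (ModuleCat.of R N) Y i) :=
      subsingleton_of_forall_eq 0 fun x ↦ by
        rw [← Ext.mk₀_id_comp x, (ModuleCat.isZero_of_subsingleton (ModuleCat.of R N)).eq_of_src
          (𝟙 _) 0, Ext.mk₀_zero, Ext.zero_comp]
    exact of_subsingleton_s15
  | quotient N q e =>
    intro hN
    refine abelianExt_of_iso e.toModuleIso (h q.1 q.2 ?_)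
    rw [e.support_eq, Module.support_quotient_ideal] at hN
    exact hN ((PrimeSpectrum.mem_zeroLocus _ _).mpr subset_rfl)
  | exact N₁ N₂ N₃ f g hf hg hfg h₁ h₃ =>
    intro hN
    exact abelianExt_of_shortExact (ModuleCat.shortComplex_shortExact
      (ModuleCat.shortComplexOfCompEqZero f g hfg.linearMap_comp_eq_zero) hfg hf hg) Y
      (h₁ ((Module.support_subset_of_injective f hf).trans hN))
      (h₃ ((Module.support_subset_of_surjective g hg).trans hN))

/-- If every prime containing `a` contains an ideal `p ≥ a` from the family `F`, and
`Ext^i(R/p, Y)` is in dimension `< n` for all `p ∈ F` and `i ≤ t`, then so is `Ext^i(N, Y)` for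
every finitely generated `N` supported in `V(a)`. -/
theorem abelianExt_of_support_subset [IsNoetherianRing R] {a : Ideal R} {F : Set (Ideal R)}
    (hF : ∀ q : Ideal R, q.IsPrime → a ≤ q → ∃ p ∈ F, a ≤ p ∧ p ≤ q) {t : ℕ}
    (Y : ModuleCat.{0} R)
    (h : ∀ p ∈ F, ∀ i ≤ t, InDimLT R (Abelian.Ext (ModuleCat.of R (R ⧸ p)) Y i) n)
    (N : Type) [AddCommGroup N] [Module R N] [Module.Finite R N]
    (hN : Module.support R N ⊆ PrimeSpectrum.zeroLocus (a : Set R)) (i : ℕ) (hi : i ≤ t) :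
    InDimLT R (Abelian.Ext (ModuleCat.of R N) Y i) n := by
  have hsurj {p q : Ideal R} (hpq : p ≤ q) :
      Function.Surjective (Submodule.mapQ p q LinearMap.id hpq) := fun x ↦ by
    obtain ⟨x, rfl⟩ := Submodule.mkQ_surjective _ x
    exact ⟨Submodule.mkQ _ x, rfl⟩
  induction i generalizing N with
  | zero =>
    refine abelianExt_of_forall_isPrime (fun q hq haq ↦ ?_) N hN
    obtain ⟨p, hpF, hap, hpq⟩ := hF q hq haq
    have : Epi (ModuleCat.ofHom (Submodule.mapQ p q LinearMap.id hpq)) :=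
      (ModuleCat.epi_iff_surjective _).mpr (hsurj hpq)
    exact abelianExt_zero_of_epi (ModuleCat.ofHom (Submodule.mapQ p q LinearMap.id hpq)) Y
      (h p hpF 0 hi)
  | succ i ih =>
    refine abelianExt_of_forall_isPrime (fun q hq haq ↦ ?_) N hN
    obtain ⟨p, hpF, hap, hpq⟩ := hF q hq haq
    refine abelianExt_succ_of_shortExact (LinearMap.shortExact_shortComplexKer (hsurj hpq)) Y
      (ih _ ?_ (Nat.le_of_succ_le hi)) (h p hpF _ hi)
    refine (Module.support_subset_of_injective _ (Submodule.subtype_injective _)).trans ?_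
    rw [Module.support_quotient_ideal]
    exact PrimeSpectrum.zeroLocus_anti_mono hap

end InDimLT

/-- For an ideal `a` of a Noetherian ring `R` and an `R`-module `M`, the following are
equivalent: (i) `Ext_R^i(R/a, M)` is in dimension `< n` for all `i ≤ t`; (ii) the same for
`R/b` for every ideal `b ⊇ a`; (iii) the same for every finitely generated module `N` with
`Supp N ⊆ V(a)`; (iv) the same for `R/p` for every minimal prime `p` over `a`. -/
theorem tfae_inDimLT_ext (R : Type) [CommRing R] [IsNoetherianRing R] (a : Ideal R)
    (t n : ℕ) (M : Type) [AddCommGroup M] [Module R M] :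
    List.TFAE
      [∀ i ≤ t, InDimLT R
          ↥(((Ext R (ModuleCat R) i).obj
              (Opposite.op (ModuleCat.of R (R ⧸ a)))).obj (ModuleCat.of R M)) n,
        ∀ b : Ideal R, a ≤ b → ∀ i ≤ t, InDimLT R
          ↥(((Ext R (ModuleCat R) i).obj
              (Opposite.op (ModuleCat.of R (R ⧸ b)))).obj (ModuleCat.of R M)) n,
        ∀ (N : Type) [AddCommGroup N] [Module R N], Module.Finite R N →
          Module.support R N ⊆ PrimeSpectrum.zeroLocus (a : Set R) →
          ∀ i ≤ t, InDimLT R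
            ↥(((Ext R (ModuleCat R) i).obj
                (Opposite.op (ModuleCat.of R N))).obj (ModuleCat.of R M)) n,
        ∀ p ∈ a.minimalPrimes, ∀ i ≤ t, InDimLT R
          ↥(((Ext R (ModuleCat R) i).obj
              (Opposite.op (ModuleCat.of R (R ⧸ p)))).obj (ModuleCat.of R M)) n] := by
  have hExt (X Y : ModuleCat.{0} R) (i : ℕ) :
      InDimLT R ↥(((Ext R (ModuleCat R) i).obj (Opposite.op X)).obj Y) n ↔
        InDimLT R (Abelian.Ext X Y i) n :=
    let e := extLinearEquivAbelianExt (R := R) X Y i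
    ⟨InDimLT.of_surjective e.toLinearMap e.surjective,
      InDimLT.of_surjective e.symm.toLinearMap e.symm.surjective⟩
  simp only [hExt]
  tfae_have 1 → 3 := fun h N _ _ _ hN ↦ InDimLT.abelianExt_of_support_subset (F := {a})
    (fun q _ haq ↦ ⟨a, rfl, le_rfl, haq⟩) _ (by rintro _ rfl; exact h) N hN
  tfae_have 3 → 2 := fun h b hab ↦ h (R ⧸ b) inferInstance <| by
    rw [Module.support_quotient_ideal]
    exact PrimeSpectrum.zeroLocus_anti_mono hab
  tfae_have 2 → 1 := fun h ↦ h a le_rfl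
  tfae_have 2 → 4 := fun h p hp ↦ h p hp.1.2
  tfae_have 4 → 3 := fun h N _ _ _ hN ↦
    InDimLT.abelianExt_of_support_subset (F := a.minimalPrimes) (fun q _ haq ↦
      let ⟨p, hp, hpq⟩ := Ideal.exists_minimalPrimes_le haq
      ⟨p, hp, hp.1.2, hpq⟩) _ h N hN
  tfae_finish
end
end

section
/- Let R be a commutative Noetherian ring, a an ideal of R, S a Serre subcategory of the category of R-modules, s a non-negative integer, and M an R-module such that Ext_R^s(R/a, M) belongs to S. If Ext_R^j(R/a, H^i_a(M)) belongs to S for all i < s and all j ≥ 0, then Hom_R(R/a, H^s_a(M)) belongs to S. -/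
open CategoryTheory

noncomputable section

/-- A property of `R`-modules is a *Serre class* if for every short exact sequence
`0 → M' → M → M'' → 0`, the middle term satisfies it iff both outer terms do
(equivalently: it is closed under submodules, quotients and extensions). -/
def IsSerreClass (R : Type) [CommRing R] (P : ModuleCat R → Prop) : Prop :=
  ∀ S : CategoryTheory.ShortComplex (ModuleCat R), S.ShortExact → (P S.X₂ ↔ P S.X₁ ∧ P S.X₃)

namespace CategoryTheory.ProjectiveResolution

variable {R : Type} [CommRing R] {X Y : ModuleCat.{0} R} (P : ProjectiveResolution X)

lemma extMk_zero_eq_zero_iff (f : P.complex.X 0 ⟶ Y) (m : ℕ) (hm : 0 + 1 = m)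
    (hf : P.complex.d m 0 ≫ f = 0) : P.extMk f m hm hf = 0 ↔ f = 0 := by
  refine ⟨fun h ↦ ?_, fun h ↦ by subst h; simp⟩
  rw [← P.extEquivCohomologyClass.apply_eq_iff_eq,
    extEquivCohomologyClass_extMk, extEquivCohomologyClass_zero,
    CochainComplex.HomComplex.CohomologyClass.mk_eq_zero_iff,
    CochainComplex.HomComplex.Cocycle.toSingleMk_mem_coboundaries_iff _ _ _ _ _ 1 (by simp)] at h
  obtain ⟨g, hg⟩ := h
  have hz : P.cochainComplex.d (-(0 : ℕ)) 1 = 0 :=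
    (CochainComplex.isZero_of_isStrictlyLE P.cochainComplex 0 1 (by simp)).eq_of_tgt _ _
  rw [hz, Limits.zero_comp] at hg
  rw [← cancel_epi (P.cochainComplexXIso (-(0 : ℕ)) 0 rfl).hom, ← hg]
  simp

lemma extMk_smul {n : ℕ} (f : P.complex.X n ⟶ Y) (m : ℕ) (hm : n + 1 = m)
    (hf : P.complex.d m n ≫ f = 0) (r : R) :
    P.extMk (r • f) m hm (by simp [hf]) = r • P.extMk f m hm hf := by
  rw [Abelian.Ext.smul_eq_comp_mk₀, extMk_comp_mk₀]
  simp

/-- A cycle of the complex of morphisms out of a projective resolution, as a morphism. -/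
def cyclesToHom (Y : ModuleCat.{0} R) (n : ℕ) :
    (P.complex.linearYonedaObj R Y).cycles n →ₗ[R] (P.complex.X n ⟶ Y) :=
  ((P.complex.linearYonedaObj R Y).iCycles n).hom

lemma d_comp_cyclesToHom (n : ℕ) (z : (P.complex.linearYonedaObj R Y).cycles n) :
    P.complex.d (n + 1) n ≫ P.cyclesToHom Y n z = 0 :=
  ConcreteCategory.congr_hom ((P.complex.linearYonedaObj R Y).iCycles_d n (n + 1)) z

/-- The class in `Ext` of a cycle of the complex of morphisms out of a projective resolution. -/
def cyclesToExt (Y : ModuleCat.{0} R) (n : ℕ) :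
    (P.complex.linearYonedaObj R Y).cycles n →ₗ[R] Abelian.Ext X Y n where
  toFun z := P.extMk (P.cyclesToHom Y n z) (n + 1) rfl (P.d_comp_cyclesToHom n z)
  map_add' z w := by
    rw [add_extMk]
    congr 1
    exact map_add _ _ _
  map_smul' r z := by
    dsimp only [RingHom.id_apply]
    rw [← extMk_smul]
    congr 1
    exact map_smul _ r z

lemma exists_cycles (K : CochainComplex (ModuleCat.{0} R) ℕ) (n : ℕ) (x : K.X n)
    (hx : K.d n (n + 1) x = 0) : ∃ z : K.cycles n, K.iCycles n z = x := by
  let k : ModuleCat.of R R ⟶ K.X n := ModuleCat.ofHom (LinearMap.toSpanSingleton R _ x)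
  have hk : k ≫ K.d n (n + 1) = 0 := by
    ext
    simpa [k] using hx
  refine ⟨K.liftCycles k (n + 1) (by simp) hk (1 : R), ?_⟩
  exact (ConcreteCategory.congr_hom (K.liftCycles_i k (n + 1) (by simp) hk) (1 : R)).trans
    (one_smul R x)

lemma cyclesToExt_surjective (n : ℕ) : Function.Surjective (P.cyclesToExt Y n) := by
  intro α
  obtain ⟨f, hf, rfl⟩ := P.extMk_surjective α (n + 1) rfl
  obtain ⟨z, hz⟩ := exists_cycles (P.complex.linearYonedaObj R Y) n f hf
  refine ⟨z, ?_⟩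
  simp only [cyclesToExt, LinearMap.coe_mk, AddHom.coe_mk]
  congr 1

lemma homologyπ_surjective (K : CochainComplex (ModuleCat.{0} R) ℕ) (n : ℕ) :
    Function.Surjective (K.homologyπ n) :=
  (ModuleCat.epi_iff_surjective _).mp inferInstance

lemma homologyπ_eq_zero_iff (K : CochainComplex (ModuleCat.{0} R) ℕ) (p n : ℕ)
    (hp : (ComplexShape.up ℕ).prev n = p) (z : K.cycles n) :
    K.homologyπ n z = 0 ↔ ∃ y : K.X p, K.d p n y = K.iCycles n z := by
  have hex : (ShortComplex.mk (K.toCycles p n) (K.homologyπ n) (by simp)).Exact :=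
    ShortComplex.exact_of_g_is_cokernel _ (K.homologyIsCokernel p n hp)
  have hi : Function.Injective (K.iCycles n) := (ModuleCat.mono_iff_injective _).mp inferInstance
  rw [ShortComplex.moduleCat_exact_iff] at hex
  constructor
  · intro h
    obtain ⟨y, hy⟩ := hex z h
    exact ⟨y, by rw [← hy]; exact (ConcreteCategory.congr_hom (K.toCycles_i p n) y).symm⟩
  · rintro ⟨y, hy⟩
    have : K.toCycles p n y = z :=
      hi ((ConcreteCategory.congr_hom (K.toCycles_i p n) y).trans hy)
    rw [← this]
    exact ConcreteCategory.congr_hom (K.toCycles_comp_homologyπ p n) y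

lemma ker_cyclesToExt (n : ℕ) : LinearMap.ker (P.cyclesToExt Y n) =
    LinearMap.ker ((P.complex.linearYonedaObj R Y).homologyπ n).hom := by
  ext z
  rw [LinearMap.mem_ker, LinearMap.mem_ker]
  cases n with
  | zero =>
    refine (P.extMk_zero_eq_zero_iff (P.cyclesToHom Y 0 z) 1 rfl (P.d_comp_cyclesToHom 0 z)).trans
      (Iff.trans ?_ (homologyπ_eq_zero_iff _ 0 0 (by simp) z).symm)
    constructor
    · intro h
      exact ⟨0, by rw [map_zero]; exact h.symm⟩
    · rintro ⟨y, hy⟩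
      refine hy.symm.trans ?_
      rw [HomologicalComplex.shape _ _ _ (by simp)]
      rfl
  | succ n =>
    exact (P.extMk_eq_zero_iff (P.cyclesToHom Y (n + 1) z) _ rfl (P.d_comp_cyclesToHom _ z) n rfl).trans
      (homologyπ_eq_zero_iff _ n (n + 1) (by simp) z).symm

/-- `Ext` in the derived category is computed by a projective resolution of the source. -/
def homologyEquivExt (Y : ModuleCat.{0} R) (n : ℕ) :
    (P.complex.linearYonedaObj R Y).homology n ≃ₗ[R] Abelian.Ext X Y n :=
  (((P.complex.linearYonedaObj R Y).homologyπ n).hom.quotKerEquivOfSurjective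
    (homologyπ_surjective _ n)).symm ≪≫ₗ
  Submodule.quotEquivOfEq _ _ (P.ker_cyclesToExt n).symm ≪≫ₗ
  (P.cyclesToExt Y n).quotKerEquivOfSurjective (P.cyclesToExt_surjective n)

lemma homologyEquivExt_π (n : ℕ) (z : (P.complex.linearYonedaObj R Y).cycles n) :
    P.homologyEquivExt Y n ((P.complex.linearYonedaObj R Y).homologyπ n z) =
      P.cyclesToExt Y n z := by
  have : (((P.complex.linearYonedaObj R Y).homologyπ n).hom.quotKerEquivOfSurjective
      (homologyπ_surjective _ n)).symm ((P.complex.linearYonedaObj R Y).homologyπ n z) =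
      Submodule.Quotient.mk z := by
    rw [LinearEquiv.symm_apply_eq]
    rfl
  simp only [homologyEquivExt, LinearEquiv.trans_apply]
  rw [this]
  rfl

/-- The map on complexes of morphisms into `Y` given by precomposition with a chain map. -/
def linearYonedaMap {K L : ChainComplex (ModuleCat.{0} R) ℕ} (φ : K ⟶ L) (Y : ModuleCat.{0} R) :
    L.linearYonedaObj R Y ⟶ K.linearYonedaObj R Y :=
  (HomologicalComplex.unopFunctor _ _).map
    ((((linearYoneda R (ModuleCat.{0} R)).obj Y).rightOp.mapHomologicalComplex _).map φ).op

variable {X' : ModuleCat.{0} R} {P} {P' : ProjectiveResolution X'} {g : X' ⟶ X}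

lemma isoExt_hom_naturality (φ : Hom P' P g) (n : ℕ) :
    ((Ext R (ModuleCat.{0} R) n).map g.op).app Y ≫ (P'.isoExt n Y).hom =
      (P.isoExt n Y).hom ≫ HomologicalComplex.homologyMap (linearYonedaMap φ.hom Y) n := by
  let F := ((linearYoneda R (ModuleCat.{0} R)).obj Y).rightOp
  let eP : (F.leftDerived n).obj X ≅ Opposite.op ((P.complex.linearYonedaObj R Y).homology n) :=
    P.isoLeftDerivedObj F n ≪≫ (P.complex.linearYonedaObj R Y).homologyOp n
  let eP' : (F.leftDerived n).obj X' ≅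
      Opposite.op ((P'.complex.linearYonedaObj R Y).homology n) :=
    P'.isoLeftDerivedObj F n ≪≫ (P'.complex.linearYonedaObj R Y).homologyOp n
  have h2 := HomologicalComplex.homologyOp_hom_naturality (linearYonedaMap φ.hom Y) n
  have h3 : (F.leftDerived n).map g ≫ eP.hom =
      eP'.hom ≫ (HomologicalComplex.homologyMap (linearYonedaMap φ.hom Y) n).op := by
    refine (isoLeftDerivedObj_hom_naturality_assoc g P' P φ.hom
      φ.hom_f_zero_comp_π_f_zero F n _).trans ?_
    refine Eq.trans ?_ (Category.assoc _ _ _).symm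
    exact congrArg ((P'.isoLeftDerivedObj F n).hom ≫ ·) h2
  have h4 : eP'.inv ≫ (F.leftDerived n).map g =
      (HomologicalComplex.homologyMap (linearYonedaMap φ.hom Y) n).op ≫ eP.inv := by
    rw [Iso.inv_comp_eq, ← Category.assoc, Iso.eq_comp_inv, h3]
  exact congrArg Quiver.Hom.unop h4

lemma homologyEquivExt_homologyMap (φ : Hom P' P g) (n : ℕ)
    (x : (P.complex.linearYonedaObj R Y).homology n) :
    P'.homologyEquivExt Y n (HomologicalComplex.homologyMap (linearYonedaMap φ.hom Y) n x) =
      (Abelian.Ext.mk₀ g).comp (P.homologyEquivExt Y n x) (zero_add n) := by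
  obtain ⟨z, rfl⟩ := homologyπ_surjective _ n x
  have h : HomologicalComplex.homologyMap (linearYonedaMap φ.hom Y) n
      ((P.complex.linearYonedaObj R Y).homologyπ n z) =
      (P'.complex.linearYonedaObj R Y).homologyπ n
        (HomologicalComplex.cyclesMap (linearYonedaMap φ.hom Y) n z) :=
    ConcreteCategory.congr_hom
      (HomologicalComplex.homologyπ_naturality (linearYonedaMap φ.hom Y) n) z
  rw [h, homologyEquivExt_π, homologyEquivExt_π]
  refine Eq.trans ?_ (mk₀_comp_extMk _ _ rfl (P.d_comp_cyclesToHom n z) φ).symm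
  dsimp only [cyclesToExt, LinearMap.coe_mk, AddHom.coe_mk]
  congr 1
  exact ConcreteCategory.congr_hom
    (HomologicalComplex.cyclesMap_i (linearYonedaMap φ.hom Y) n) z

end CategoryTheory.ProjectiveResolution

section

variable {R : Type} [CommRing R]

/-- The comparison between `Ext` as a derived functor and `Ext` in the derived category. -/
def extEquiv (X Y : ModuleCat.{0} R) (n : ℕ) :
    ((Ext R (ModuleCat.{0} R) n).obj (Opposite.op X)).obj Y ≃ₗ[R] Abelian.Ext X Y n :=
  ((projectiveResolution X).isoExt n Y).toLinearEquiv ≪≫ₗ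
    (projectiveResolution X).homologyEquivExt Y n

lemma extEquiv_naturality {X X' : ModuleCat.{0} R} (g : X' ⟶ X) (Y : ModuleCat.{0} R) (n : ℕ)
    (x : ((Ext R (ModuleCat.{0} R) n).obj (Opposite.op X)).obj Y) :
    extEquiv X' Y n (((Ext R (ModuleCat.{0} R) n).map g.op).app Y x) =
      (Abelian.Ext.mk₀ g).comp (extEquiv X Y n x) (zero_add n) := by
  let φ : (projectiveResolution X').Hom (projectiveResolution X) g :=
    ⟨ProjectiveResolution.lift g _ _, ProjectiveResolution.lift_commutes_zero g _ _⟩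
  refine Eq.trans ?_ (ProjectiveResolution.homologyEquivExt_homologyMap φ n _)
  exact congrArg ((projectiveResolution X').homologyEquivExt Y n) (ConcreteCategory.congr_hom
    (ProjectiveResolution.isoExt_hom_naturality (Y := Y) φ n) x)

end

section

variable {R : Type} [CommRing R]

/-- The submodule of elements annihilated by a power of the ideal `a`. -/
def idealTorsion (a : Ideal R) (M : Type) [AddCommGroup M] [Module R M] : Submodule R M where
  carrier := {x | ∃ n : ℕ, ∀ r ∈ a ^ n, r • x = 0}
  zero_mem' := ⟨0, fun r _ ↦ smul_zero r⟩
  add_mem' := by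
    rintro x y ⟨n, hn⟩ ⟨m, hm⟩
    refine ⟨n + m, fun r hr ↦ ?_⟩
    rw [smul_add, hn r (Ideal.pow_le_pow_right (Nat.le_add_right n m) hr),
      hm r (Ideal.pow_le_pow_right (Nat.le_add_left m n) hr), add_zero]
  smul_mem' := by
    rintro c x ⟨n, hn⟩
    exact ⟨n, fun r hr ↦ by rw [smul_comm, hn r hr, smul_zero]⟩

variable {a : Ideal R} {M N : Type} [AddCommGroup M] [Module R M] [AddCommGroup N] [Module R N]

lemma map_mem_idealTorsion (f : M →ₗ[R] N) {x : M} (hx : x ∈ idealTorsion a M) :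
    f x ∈ idealTorsion a N := by
  obtain ⟨n, hn⟩ := hx
  exact ⟨n, fun r hr ↦ by rw [← map_smul, hn r hr, map_zero]⟩

lemma mem_idealTorsion_of_injective (f : M →ₗ[R] N) (hf : Function.Injective f) {x : M}
    (hx : f x ∈ idealTorsion a N) : x ∈ idealTorsion a M := by
  obtain ⟨n, hn⟩ := hx
  exact ⟨n, fun r hr ↦ hf (by rw [map_smul, hn r hr, map_zero])⟩

lemma apply_mem_idealTorsion {b : Ideal R} {n : ℕ} (h : a ^ n ≤ b) (f : (R ⧸ b) →ₗ[R] M)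
    (x : R ⧸ b) : f x ∈ idealTorsion a M := by
  refine map_mem_idealTorsion f ⟨n, fun r hr ↦ ?_⟩
  obtain ⟨x, rfl⟩ := Ideal.Quotient.mk_surjective x
  exact Ideal.Quotient.eq_zero_iff_mem.mpr (b.mul_mem_right x (h hr))

lemma exists_pow_smul_apply_eq_zero [IsNoetherian R M] (f : M →ₗ[R] N)
    (hf : ∀ x, f x ∈ idealTorsion a N) : ∃ n : ℕ, ∀ x, ∀ r ∈ a ^ n, r • f x = 0 := by
  let K : ℕ →o Submodule R M :=
    { toFun n :=
        { carrier := {x | ∀ r ∈ a ^ n, r • f x = 0}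
          zero_mem' := by simp
          add_mem' := fun {x y} hx hy r hr ↦ by
            rw [map_add, smul_add, hx r hr, hy r hr, add_zero]
          smul_mem' := fun c x hx r hr ↦ by
            rw [map_smul, smul_comm, hx r hr, smul_zero] }
      monotone' := fun n m h x hx r hr ↦ hx r (Ideal.pow_le_pow_right h hr) }
  obtain ⟨n, hn⟩ := monotone_stabilizes_iff_noetherian.mpr ‹_› K
  refine ⟨n, fun x ↦ ?_⟩
  obtain ⟨m, hm⟩ := hf x
  have hx : x ∈ K (n + m) := fun r hr ↦ hm r (Ideal.pow_le_pow_right (Nat.le_add_left m n) hr)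
  rwa [← hn (n + m) (Nat.le_add_right n m)] at hx

/-- Over a Noetherian ring, the torsion submodule of an injective module is injective. -/
lemma injective_idealTorsion [IsNoetherianRing R] (a : Ideal R) (I : Type) [AddCommGroup I]
    [Module R I] [Module.Injective R I] : Module.Injective R (idealTorsion a I) := by
  refine Module.Baer.injective fun b g ↦ ?_
  obtain ⟨n, hn⟩ := exists_pow_smul_apply_eq_zero (a := a) ((idealTorsion a I).subtype ∘ₗ g)
    fun x ↦ (g x).2
  obtain ⟨k, hk⟩ := Ideal.exists_pow_inf_eq_pow_smul a (b : Submodule R R)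
  have hle : a ^ (k + n) ⊓ b ≤ (LinearMap.ker g).map b.subtype := by
    have h := hk (k + n) (Nat.le_add_right k n)
    rw [Ideal.smul_eq_mul, Ideal.mul_top, Nat.add_sub_cancel_left] at h
    rw [h, Submodule.smul_le]
    intro r hr x hx
    refine ⟨r • ⟨x, hx.2⟩, ?_, rfl⟩
    rw [SetLike.mem_coe, LinearMap.mem_ker, map_smul]
    exact Subtype.ext (hn ⟨x, hx.2⟩ r hr)
  let u : b →ₗ[R] R ⧸ a ^ (k + n) := Submodule.mkQ (a ^ (k + n)) ∘ₗ b.subtype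
  have hu : LinearMap.ker u ≤ LinearMap.ker g := by
    intro x hx
    have hx' : (x : R) ∈ a ^ (k + n) := (Submodule.Quotient.mk_eq_zero _).mp hx
    obtain ⟨y, hy, hyx⟩ := hle ⟨hx', x.2⟩
    rwa [← Subtype.ext hyx]
  obtain ⟨h, hh⟩ := Module.Injective.out ((LinearMap.ker u).liftQ u le_rfl)
    (LinearMap.ker_eq_bot.mp (Submodule.ker_liftQ_eq_bot _ _ _ le_rfl))
    ((LinearMap.ker u).liftQ ((idealTorsion a I).subtype ∘ₗ g) fun x hx ↦ by
      simpa using hu hx)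
  refine ⟨(h ∘ₗ Submodule.mkQ (a ^ (k + n))).codRestrict (idealTorsion a I)
    fun x ↦ apply_mem_idealTorsion le_rfl h _, fun x hx ↦ Subtype.ext ?_⟩
  exact hh (Submodule.Quotient.mk ⟨x, hx⟩)

lemma exists_section_mkQ_idealTorsion [IsNoetherianRing R] (a : Ideal R) (I : Type)
    [AddCommGroup I] [Module R I] [Module.Injective R I] :
    ∃ s : (I ⧸ idealTorsion a I) →ₗ[R] I, (idealTorsion a I).mkQ ∘ₗ s = LinearMap.id := by
  have := injective_idealTorsion a I
  obtain ⟨r, hr⟩ := Module.Injective.out (idealTorsion a I).subtype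
    (Submodule.subtype_injective _) (LinearMap.id : idealTorsion a I →ₗ[R] _)
  refine ⟨(idealTorsion a I).liftQ (LinearMap.id - (idealTorsion a I).subtype ∘ₗ r)
    fun x hx ↦ ?_, ?_⟩
  · have := congrArg Subtype.val (hr ⟨x, hx⟩)
    simp only [Submodule.subtype_apply, LinearMap.id_apply] at this
    simp [this]
  · ext x
    simp

lemma injective_quotient_idealTorsion [IsNoetherianRing R] (a : Ideal R) (I : Type)
    [AddCommGroup I] [Module R I] [Module.Injective R I] :
    Module.Injective R (I ⧸ idealTorsion a I) := by
  obtain ⟨s, hs⟩ := exists_section_mkQ_idealTorsion a I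
  refine ⟨fun X Y _ _ _ _ f hf g ↦ ?_⟩
  obtain ⟨h, hh⟩ := Module.Injective.out f hf (s ∘ₗ g)
  refine ⟨(idealTorsion a I).mkQ ∘ₗ h, fun x ↦ ?_⟩
  rw [LinearMap.comp_apply, hh]
  exact LinearMap.congr_fun hs (g x)

lemma idealTorsion_quotient_idealTorsion [IsNoetherianRing R] (a : Ideal R) (I : Type)
    [AddCommGroup I] [Module R I] [Module.Injective R I] :
    idealTorsion a (I ⧸ idealTorsion a I) = ⊥ := by
  obtain ⟨s, hs⟩ := exists_section_mkQ_idealTorsion a I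
  refine (Submodule.eq_bot_iff _).mpr fun x hx ↦ ?_
  rw [← LinearMap.id_apply (R := R) x, ← hs]
  exact (Submodule.Quotient.mk_eq_zero _).mpr (map_mem_idealTorsion s hx)

lemma shortExact_mkQ_range (f : M →ₗ[R] N) (hf : Function.Injective f) :
    (ShortComplex.mk (ModuleCat.ofHom f) (ModuleCat.ofHom (LinearMap.range f).mkQ)
      (by ext x; simp)).ShortExact where
  exact := by
    rw [ShortComplex.moduleCat_exact_iff]
    intro x hx
    obtain ⟨y, hy⟩ := (Submodule.Quotient.mk_eq_zero _).mp hx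
    exact ⟨y, hy⟩
  mono_f := (ModuleCat.mono_iff_injective _).mpr hf
  epi_g := (ModuleCat.epi_iff_surjective _).mpr (Submodule.mkQ_surjective _)

lemma shortExact_subtype_mkQ (p : Submodule R M) :
    (ShortComplex.mk (ModuleCat.ofHom p.subtype) (ModuleCat.ofHom p.mkQ)
      (by ext x; simp)).ShortExact where
  exact := by
    rw [ShortComplex.moduleCat_exact_iff]
    intro x hx
    exact ⟨⟨x, (Submodule.Quotient.mk_eq_zero _).mp hx⟩, rfl⟩
  mono_f := (ModuleCat.mono_iff_injective _).mpr p.subtype_injective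
  epi_g := (ModuleCat.epi_iff_surjective _).mpr p.mkQ_surjective

lemma exists_injective_embedding (R : Type) [CommRing R] (M : Type) [AddCommGroup M]
    [Module R M] : ∃ (I : Type) (_ : AddCommGroup I) (_ : Module R I) (f : M →ₗ[R] I),
      Module.Injective R I ∧ Function.Injective f :=
  ⟨(Injective.under (ModuleCat.of R M) : ModuleCat.{0} R), inferInstance, inferInstance,
    (Injective.ι (ModuleCat.of R M)).hom,
    @Module.injective_module_of_injective_object R _ _ _ _
      (inferInstanceAs (Injective (Injective.under (ModuleCat.of R M)))),
    (ModuleCat.mono_iff_injective _).mp inferInstance⟩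

end

section

open Abelian

variable {R : Type} [CommRing R]

/-- The transition morphism `R / a ^ m ⟶ R / a ^ n` for `n ≤ m`. -/
def powQuotMap (a : Ideal R) {n m : ℕ} (h : n ≤ m) :
    ModuleCat.of R (R ⧸ a ^ m) ⟶ ModuleCat.of R (R ⧸ a ^ n) :=
  ModuleCat.ofHom (Submodule.mapQ _ _ LinearMap.id (Ideal.pow_le_pow_right h))

lemma powQuotMap_comp (a : Ideal R) {n m k : ℕ} (h : n ≤ m) (h' : m ≤ k) :
    powQuotMap a h' ≫ powQuotMap a h = powQuotMap a (h.trans h') := by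
  ext
  rfl

lemma ext_eq_zero_of_idealTorsion_eq_bot {a b : Ideal R} {n : ℕ} (hb : a ^ n ≤ b) (E : Type)
    [AddCommGroup E] [Module R E] [Module.Injective R E] (hE : idealTorsion a E = ⊥) (i : ℕ)
    (x : Ext (ModuleCat.of R (R ⧸ b)) (ModuleCat.of R E) i) : x = 0 := by
  cases i with
  | zero =>
    obtain ⟨f, rfl⟩ := Ext.homEquiv₀.symm.surjective x
    have : f = 0 := by
      ext
      exact (Submodule.eq_bot_iff _).mp hE _ (apply_mem_idealTorsion hb f.hom _)
    rw [this]
    simp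
  | succ i =>
    have := Module.injective_object_of_injective_module R E
    exact Ext.eq_zero_of_injective x

lemma exists_powQuotMap_comp_eq_zero [IsNoetherianRing R] (a : Ideal R) (i : ℕ) :
    ∀ (T : Type) [AddCommGroup T] [Module R T], idealTorsion a T = ⊤ → ∀ (n : ℕ)
      (x : Ext (ModuleCat.of R (R ⧸ a ^ n)) (ModuleCat.of R T) (i + 1)),
      ∃ (m : ℕ) (h : n ≤ m), (Ext.mk₀ (powQuotMap a h)).comp x (zero_add _) = 0 := by
  induction i with
  | zero =>
    intro T _ _ hT n x
    obtain ⟨I, _, _, f, _, hf⟩ := exists_injective_embedding R T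
    have hJ := injective_idealTorsion a I
    let g : T →ₗ[R] idealTorsion a I :=
      f.codRestrict _ fun x ↦ map_mem_idealTorsion f (hT ▸ Submodule.mem_top)
    have hg : Function.Injective g := fun x y h ↦ hf (congrArg Subtype.val h)
    have hS := shortExact_mkQ_range g hg
    have := Module.injective_object_of_injective_module R (idealTorsion a I)
    obtain ⟨y, rfl⟩ := Ext.covariant_sequence_exact₁ _ hS x
      (Ext.eq_zero_of_injective (I := ModuleCat.of R (idealTorsion a I)) _) rfl
    obtain ⟨q, rfl⟩ := Ext.homEquiv₀.symm.surjective y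
    obtain ⟨z, hz⟩ := Submodule.mkQ_surjective _ (q (Submodule.Quotient.mk 1))
    obtain ⟨k, hk⟩ := z.2
    refine ⟨n + k, Nat.le_add_right n k, ?_⟩
    let p : ModuleCat.of R (R ⧸ a ^ (n + k)) ⟶ ModuleCat.of R (idealTorsion a I) :=
      ModuleCat.ofHom (Submodule.liftQ _ (LinearMap.toSpanSingleton R _ z) fun r hr ↦
        Subtype.ext (hk r (Ideal.pow_le_pow_right (Nat.le_add_left k n) hr)))
    have hp : powQuotMap a (Nat.le_add_right n k) ≫ q =
        p ≫ ModuleCat.ofHom (LinearMap.range g).mkQ := by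
      ext
      exact hz.symm.trans (congrArg _ (one_smul R z).symm)
    rw [Ext.homEquiv₀_symm_apply, ← Ext.comp_assoc _ _ _ (zero_add 0) (zero_add 1) (by simp),
      Ext.mk₀_comp_mk₀, hp, ← Ext.mk₀_comp_mk₀,
      Ext.comp_assoc _ _ _ (zero_add 0) (zero_add 1) (by simp)]
    exact (congrArg (fun t ↦ (Ext.mk₀ p).comp t (zero_add 1)) hS.comp_extClass).trans
      (Ext.comp_zero _ _ _ _ _)
  | succ i ih =>
    intro T _ _ hT n x
    obtain ⟨I, _, _, f, _, hf⟩ := exists_injective_embedding R T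
    have hJ := injective_idealTorsion a I
    let g : T →ₗ[R] idealTorsion a I :=
      f.codRestrict _ fun x ↦ map_mem_idealTorsion f (hT ▸ Submodule.mem_top)
    have hg : Function.Injective g := fun x y h ↦ hf (congrArg Subtype.val h)
    have hS := shortExact_mkQ_range g hg
    have := Module.injective_object_of_injective_module R (idealTorsion a I)
    obtain ⟨y, rfl⟩ := Ext.covariant_sequence_exact₁ _ hS x
      (Ext.eq_zero_of_injective (I := ModuleCat.of R (idealTorsion a I)) _) rfl
    have hQ : idealTorsion a (idealTorsion a I ⧸ LinearMap.range g) = ⊤ := by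
      refine (Submodule.eq_top_iff').mpr fun z ↦ ?_
      obtain ⟨z, rfl⟩ := Submodule.mkQ_surjective _ z
      exact map_mem_idealTorsion _ (mem_idealTorsion_of_injective (idealTorsion a I).subtype
        (Submodule.subtype_injective _) z.2)
    obtain ⟨m, h, hm⟩ := ih _ hQ n y
    refine ⟨m, h, ?_⟩
    rw [← Ext.comp_assoc _ _ _ (zero_add _) rfl (by simp)]
    exact (congrArg (fun t ↦ t.comp hS.extClass rfl) hm).trans
      (Ext.zero_comp _ _ _ _ _)

end

section

open Abelian

variable {R : Type} [CommRing R]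

/-- Two direct limits of the same system of modules indexed by `ℕ` are isomorphic. -/
lemma nonempty_linearEquiv_of_directLimit {A : ℕ → Type} [∀ n, AddCommGroup (A n)]
    [∀ n, Module R (A n)] (τ : ∀ {n m : ℕ}, n ≤ m → A n → A m) {L L' : Type}
    [AddCommGroup L] [Module R L] [AddCommGroup L'] [Module R L']
    (ι : ∀ n, A n →ₗ[R] L) (hι : ∀ (n m : ℕ) (h : n ≤ m) (x : A n), ι m (τ h x) = ι n x)
    (hs : ∀ y, ∃ n x, ι n x = y) (hz : ∀ n x, ι n x = 0 → ∃ (m : ℕ) (h : n ≤ m), τ h x = 0)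
    (ι' : ∀ n, A n →ₗ[R] L') (hι' : ∀ (n m : ℕ) (h : n ≤ m) (x : A n), ι' m (τ h x) = ι' n x)
    (hs' : ∀ y, ∃ n x, ι' n x = y)
    (hz' : ∀ n x, ι' n x = 0 → ∃ (m : ℕ) (h : n ≤ m), τ h x = 0) :
    Nonempty (L ≃ₗ[R] L') := by
  let u := DirectSum.toModule R ℕ L ι
  let u' := DirectSum.toModule R ℕ L' ι'
  have key (x) : ∃ n y, u x = ι n y ∧ u' x = ι' n y := by
    induction x using DirectSum.induction_on with
    | zero => exact ⟨0, 0, by simp, by simp⟩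
    | of n y => exact ⟨n, y, DirectSum.toModule_lof R n y, DirectSum.toModule_lof R n y⟩
    | add x x' hx hx' =>
      obtain ⟨n, y, h, h'⟩ := hx
      obtain ⟨m, z, k, k'⟩ := hx'
      refine ⟨n + m, τ (Nat.le_add_right n m) y + τ (Nat.le_add_left m n) z, ?_, ?_⟩
      · rw [map_add, map_add, hι, hι, h, k]
      · rw [map_add, map_add, hι', hι', h', k']
  have hu : Function.Surjective u := fun y ↦ by
    obtain ⟨n, x, rfl⟩ := hs y
    exact ⟨DirectSum.lof R ℕ _ n x, DirectSum.toModule_lof R n x⟩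
  have hu' : Function.Surjective u' := fun y ↦ by
    obtain ⟨n, x, rfl⟩ := hs' y
    exact ⟨DirectSum.lof R ℕ _ n x, DirectSum.toModule_lof R n x⟩
  have hker : LinearMap.ker u = LinearMap.ker u' := by
    ext x
    obtain ⟨n, y, h, h'⟩ := key x
    rw [LinearMap.mem_ker, LinearMap.mem_ker, h, h']
    constructor
    · intro hy
      obtain ⟨m, hm, e⟩ := hz n y hy
      rw [← hι' n m hm, e, map_zero]
    · intro hy
      obtain ⟨m, hm, e⟩ := hz' n y hy
      rw [← hι n m hm, e, map_zero]
  exact ⟨(u.quotKerEquivOfSurjective hu).symm ≪≫ₗ Submodule.quotEquivOfEq _ _ hker ≪≫ₗ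
    u'.quotKerEquivOfSurjective hu'⟩

/-- `L` is a direct limit of the system `Ext^i(R / a ^ n, M)`. -/
def IsExtLimit (a : Ideal R) (M : ModuleCat.{0} R) (i : ℕ) (L : Type) [AddCommGroup L]
    [Module R L] : Prop :=
  ∃ ι : ∀ n : ℕ, Ext (ModuleCat.of R (R ⧸ a ^ n)) M i →ₗ[R] L,
    (∀ (n m : ℕ) (h : n ≤ m) (x : Ext (ModuleCat.of R (R ⧸ a ^ n)) M i),
      ι m ((Ext.mk₀ (powQuotMap a h)).comp x (zero_add i)) = ι n x) ∧
    (∀ y : L, ∃ n x, ι n x = y) ∧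
    ∀ n x, ι n x = 0 →
      ∃ (m : ℕ) (h : n ≤ m), (Ext.mk₀ (powQuotMap a h)).comp x (zero_add i) = 0

namespace IsExtLimit

variable {a : Ideal R} {M N : ModuleCat.{0} R} {i j d : ℕ} {L L' : Type}
  [AddCommGroup L] [Module R L] [AddCommGroup L'] [Module R L']

lemma nonempty_linearEquiv (hL : IsExtLimit a M i L) (hL' : IsExtLimit a M i L') :
    Nonempty (L ≃ₗ[R] L') := by
  obtain ⟨ι, hι, hs, hz⟩ := hL
  obtain ⟨ι', hι', hs', hz'⟩ := hL'
  exact nonempty_linearEquiv_of_directLimit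
    (fun h x ↦ (Ext.mk₀ (powQuotMap a h)).comp x (zero_add i)) ι hι hs hz ι' hι' hs' hz'

lemma of_comp (hL : IsExtLimit a M i L) (e : Ext N M d) (hd : j + d = i)
    (hinj : ∀ (n : ℕ) (x : Ext (ModuleCat.of R (R ⧸ a ^ n)) N j), x.comp e hd = 0 →
      ∃ (m : ℕ) (h : n ≤ m), (Ext.mk₀ (powQuotMap a h)).comp x (zero_add j) = 0)
    (hsurj : ∀ (n : ℕ) (y : Ext (ModuleCat.of R (R ⧸ a ^ n)) M i),
      ∃ (m : ℕ) (h : n ≤ m) (x : Ext (ModuleCat.of R (R ⧸ a ^ m)) N j),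
        x.comp e hd = (Ext.mk₀ (powQuotMap a h)).comp y (zero_add i)) :
    IsExtLimit a N j L := by
  obtain ⟨ι, hι, hs, hz⟩ := hL
  refine ⟨fun n ↦ ι n ∘ₗ e.postcompOfLinear R _ hd, fun n m h x ↦ ?_, fun y ↦ ?_,
    fun n x hx ↦ ?_⟩
  · refine Eq.trans ?_ (hι n m h (x.comp e hd))
    exact congrArg (ι m) (Ext.comp_assoc _ _ _ _ _ (by lia))
  · obtain ⟨n, x, rfl⟩ := hs y
    obtain ⟨m, h, z, hxz⟩ := hsurj n x
    exact ⟨m, z, (congrArg (ι m) hxz).trans (hι n m h x)⟩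
  · obtain ⟨m, h, hm⟩ := hz n (x.comp e hd) hx
    rw [← Ext.comp_assoc _ _ _ (zero_add j) hd (by lia)] at hm
    obtain ⟨k, h', hk⟩ := hinj m _ hm
    refine ⟨k, h.trans h', ?_⟩
    rwa [← Ext.comp_assoc _ _ _ (zero_add 0) (zero_add j) (by lia), Ext.mk₀_comp_mk₀,
      powQuotMap_comp] at hk

end IsExtLimit

lemma isExtLimit_locCoh (a : Ideal R) (M : Type) [AddCommGroup M] [Module R M] (i : ℕ) :
    IsExtLimit a (ModuleCat.of R M) i (locCoh R a i M) := by
  let D := localCohomology.diagram (localCohomology.idealPowersDiagram a) i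
  let F := D.flip.obj (ModuleCat.of R M)
  let c : Limits.Cocone F :=
    ((evaluation _ _).obj (ModuleCat.of R M)).mapCocone (Limits.colimit.cocone D)
  have hc : Limits.IsColimit c :=
    Limits.isColimitOfPreserves ((evaluation _ _).obj (ModuleCat.of R M))
      (Limits.colimit.isColimit D)
  let e (n : ℕ) : F.obj (Opposite.op (Opposite.op n)) ≃ₗ[R]
      Ext (ModuleCat.of R (R ⧸ a ^ n)) (ModuleCat.of R M) i := extEquiv _ _ i
  have he (n m : ℕ) (h : n ≤ m) (x) : e m (F.map (homOfLE h).op.op x) =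
      (Ext.mk₀ (powQuotMap a h)).comp (e n x) (zero_add i) :=
    extEquiv_naturality (powQuotMap a h) _ i x
  refine ⟨fun n ↦ (c.ι.app (Opposite.op (Opposite.op n))).hom ∘ₗ (e n).symm.toLinearMap,
    fun n m h x ↦ ?_, fun y ↦ ?_, fun n x hx ↦ ?_⟩
  · obtain ⟨x, rfl⟩ := (e n).surjective x
    rw [← he]
    refine (congrArg (c.ι.app _) ((e m).symm_apply_apply _)).trans ?_
    refine (ConcreteCategory.congr_hom (c.w (homOfLE h).op.op) x).trans ?_
    exact (congrArg (c.ι.app _) ((e n).symm_apply_apply x)).symm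
  · obtain ⟨n, x, rfl⟩ := Limits.Concrete.isColimit_exists_rep F hc y
    exact ⟨n.unop.unop, e _ x, congrArg (c.ι.app n) ((e _).symm_apply_apply x)⟩
  · obtain ⟨x, rfl⟩ := (e n).surjective x
    have hx' : c.ι.app (Opposite.op (Opposite.op n)) x =
        c.ι.app (Opposite.op (Opposite.op n)) 0 := by
      rw [map_zero]
      exact (congrArg (c.ι.app _) ((e n).symm_apply_apply x)).symm.trans hx
    obtain ⟨k, f, g, hk⟩ := (Limits.Concrete.isColimit_rep_eq_iff_exists F hc _ _).mp hx'
    refine ⟨k.unop.unop, leOfHom f.unop.unop, ?_⟩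
    rw [← he]
    refine (congrArg (e _) (hk.trans (map_zero _))).trans (map_zero _)

lemma isExtLimit_idealTorsion (a : Ideal R) (M : Type) [AddCommGroup M] [Module R M] :
    IsExtLimit a (ModuleCat.of R M) 0 (idealTorsion a M) := by
  let v (n : ℕ) : Ext (ModuleCat.of R (R ⧸ a ^ n)) (ModuleCat.of R M) 0 →ₗ[R] M :=
    LinearMap.applyₗ (Submodule.Quotient.mk 1 : R ⧸ a ^ n) ∘ₗ
      ModuleCat.homLinearEquiv.toLinearMap ∘ₗ Ext.linearEquiv₀.toLinearMap
  have hv (n : ℕ) (f : ModuleCat.of R (R ⧸ a ^ n) ⟶ ModuleCat.of R M) :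
      v n (Ext.mk₀ f) = f (Submodule.Quotient.mk 1) := by
    have : Ext.linearEquiv₀ (R := R) (Ext.mk₀ f) = f := Ext.homEquiv₀.apply_symm_apply f
    exact congrArg (fun g : ModuleCat.of R (R ⧸ a ^ n) ⟶ ModuleCat.of R M ↦
      g (Submodule.Quotient.mk 1)) this
  have hinj (n : ℕ) (x) (hx : v n x = 0) : x = 0 := by
    obtain ⟨f, rfl⟩ := Ext.homEquiv₀.symm.surjective x
    have hf : f = 0 := by
      ext
      exact (hv n f).symm.trans hx
    simp [hf]
  have hmem (n : ℕ) (x) : v n x ∈ idealTorsion a M := by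
    obtain ⟨f, rfl⟩ := Ext.homEquiv₀.symm.surjective x
    rw [Ext.homEquiv₀_symm_apply, hv]
    exact apply_mem_idealTorsion le_rfl f.hom _
  refine ⟨fun n ↦ (v n).codRestrict _ (hmem n), fun n m h x ↦ ?_, fun y ↦ ?_, fun n x hx ↦ ?_⟩
  · obtain ⟨f, rfl⟩ := Ext.homEquiv₀.symm.surjective x
    apply Subtype.ext
    change v m _ = v n _
    rw [Ext.homEquiv₀_symm_apply, Ext.mk₀_comp_mk₀, hv, hv]
    rfl
  · obtain ⟨n, hn⟩ := y.2
    refine ⟨n, Ext.mk₀ (ModuleCat.ofHom (Submodule.liftQ (a ^ n)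
      (LinearMap.toSpanSingleton R M y) fun r hr ↦ hn r hr)), Subtype.ext ((hv _ _).trans ?_)⟩
    exact one_smul R (y : M)
  · refine ⟨n, le_rfl, ?_⟩
    rw [hinj n x (congrArg Subtype.val hx), Ext.comp_zero]

lemma comp_extClass_bijective {S : ShortComplex (ModuleCat.{0} R)} (hS : S.ShortExact)
    (X : ModuleCat.{0} R) (hX : ∀ i (x : Ext X S.X₂ i), x = 0) (i : ℕ) :
    Function.Bijective fun x : Ext X S.X₃ i ↦ x.comp hS.extClass (rfl : i + 1 = i + 1) := by
  constructor
  · intro x y hxy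
    have h : (x - y).comp hS.extClass (rfl : i + 1 = i + 1) = 0 := by
      have := map_sub (hS.extClass.postcomp X (rfl : i + 1 = i + 1)) x y
      exact this.trans (sub_eq_zero.mpr hxy)
    obtain ⟨z, hz⟩ := Ext.covariant_sequence_exact₃ _ hS _ rfl h
    rw [hX i z, Ext.zero_comp] at hz
    exact sub_eq_zero.mp hz.symm
  · intro x
    exact Ext.covariant_sequence_exact₁ _ hS x (hX _ _) rfl

/-- Dimension shifting in a short exact sequence whose middle term is acyclic. -/
def extClassEquiv {S : ShortComplex (ModuleCat.{0} R)} (hS : S.ShortExact)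
    (X : ModuleCat.{0} R) (hX : ∀ i (x : Ext X S.X₂ i), x = 0) (i : ℕ) :
    Ext X S.X₃ i ≃ₗ[R] Ext X S.X₁ (i + 1) :=
  LinearEquiv.ofBijective (hS.extClass.postcompOfLinear R X rfl)
    (comp_extClass_bijective hS X hX i)

lemma IsExtLimit.of_shortExact {a : Ideal R} {i : ℕ} {L : Type} [AddCommGroup L] [Module R L]
    {S : ShortComplex (ModuleCat.{0} R)} (hS : S.ShortExact)
    (h : ∀ n i (x : Ext (ModuleCat.of R (R ⧸ a ^ n)) S.X₂ i), x = 0)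
    (hL : IsExtLimit a S.X₁ (i + 1) L) : IsExtLimit a S.X₃ i L := by
  refine hL.of_comp hS.extClass rfl (fun n x hx ↦ ⟨n, le_rfl, ?_⟩) fun n y ↦ ⟨n, le_rfl, ?_⟩
  · rw [(comp_extClass_bijective hS _ (h n) i).1
      (hx.trans (Ext.zero_comp _ _ _ _ _).symm), Ext.comp_zero]
  · exact (comp_extClass_bijective hS _ (h n) i).2 _

lemma IsExtLimit.of_quotient_idealTorsion [IsNoetherianRing R] {a : Ideal R} {i : ℕ}
    {M L : Type} [AddCommGroup M] [Module R M] [AddCommGroup L] [Module R L]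
    (hL : IsExtLimit a (ModuleCat.of R (M ⧸ idealTorsion a M)) (i + 1) L) :
    IsExtLimit a (ModuleCat.of R M) (i + 1) L := by
  have hS := shortExact_subtype_mkQ (idealTorsion a M)
  have hT : idealTorsion a (idealTorsion a M) = ⊤ :=
    (Submodule.eq_top_iff').mpr fun z ↦ mem_idealTorsion_of_injective
      (idealTorsion a M).subtype (Submodule.subtype_injective _) z.2
  refine hL.of_comp (Ext.mk₀ (ModuleCat.ofHom (idealTorsion a M).mkQ)) (add_zero _)
    (fun n x hx ↦ ?_) fun n y ↦ ?_
  · obtain ⟨z, rfl⟩ := Ext.covariant_sequence_exact₂ _ hS x hx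
    obtain ⟨m, h, hm⟩ := exists_powQuotMap_comp_eq_zero a i _ hT n z
    refine ⟨m, h, ?_⟩
    rw [← Ext.comp_assoc _ _ _ (zero_add _) (add_zero _) (by lia)]
    exact (congrArg (fun t ↦ t.comp (Ext.mk₀ (ModuleCat.ofHom (idealTorsion a M).subtype))
      (add_zero _)) hm).trans (Ext.zero_comp _ _ _ _ _)
  · obtain ⟨m, h, hm⟩ := exists_powQuotMap_comp_eq_zero a (i + 1) _ hT n
      (y.comp hS.extClass rfl)
    rw [← Ext.comp_assoc _ _ _ (zero_add _) rfl (by lia)] at hm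
    obtain ⟨x, hx⟩ := Ext.covariant_sequence_exact₃ _ hS _ rfl hm
    exact ⟨m, h, x, hx⟩

end

section

variable {R : Type} [CommRing R]

namespace IsSerreClass

variable {P : ModuleCat R → Prop} {A B C : Type} [AddCommGroup A] [Module R A]
  [AddCommGroup B] [Module R B] [AddCommGroup C] [Module R C]

lemma submodule (hP : IsSerreClass R P) (h : P (ModuleCat.of R A)) (p : Submodule R A) :
    P (ModuleCat.of R p) :=
  ((hP _ (shortExact_subtype_mkQ p)).mp h).1

lemma quotient (hP : IsSerreClass R P) (h : P (ModuleCat.of R A)) (p : Submodule R A) :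
    P (ModuleCat.of R (A ⧸ p)) :=
  ((hP _ (shortExact_subtype_mkQ p)).mp h).2

lemma of_linearEquiv (hP : IsSerreClass R P) (h : P (ModuleCat.of R A)) (e : A ≃ₗ[R] B) :
    P (ModuleCat.of R B) := by
  have hS := shortExact_mkQ_range e.toLinearMap e.injective
  have : Subsingleton (B ⧸ LinearMap.range e.toLinearMap) := by
    rw [LinearEquiv.range]
    infer_instance
  have h0 : P (ModuleCat.of R (B ⧸ LinearMap.range e.toLinearMap)) := by
    have hS' : (ShortComplex.mk (ModuleCat.ofHom (0 : (B ⧸ LinearMap.range e.toLinearMap) →ₗ[R] A))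
        (𝟙 (ModuleCat.of R A)) (by ext; simp)).ShortExact := by
      refine { exact := ?_, mono_f := ?_, epi_g := inferInstanceAs (Epi (𝟙 _)) }
      · rw [ShortComplex.moduleCat_exact_iff]
        intro x hx
        exact ⟨0, (map_zero _).trans (Eq.symm hx)⟩
      · exact (ModuleCat.mono_iff_injective _).mpr (Function.injective_of_subsingleton _)
    exact ((hP _ hS').mp h).1
  exact (hP _ hS).mpr ⟨h, h0⟩

/-- A Serre class contains the middle term of an exact sequence if it contains the others. -/
lemma of_exact (hP : IsSerreClass R P) (hA : P (ModuleCat.of R A)) (hC : P (ModuleCat.of R C))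
    (f : A →ₗ[R] B) (g : B →ₗ[R] C) (h : Function.Exact f g) : P (ModuleCat.of R B) := by
  refine (hP _ (shortExact_subtype_mkQ (LinearMap.ker g))).mpr ⟨?_, ?_⟩
  · refine hP.of_linearEquiv (hP.quotient hA (LinearMap.ker f)) ?_
    exact f.quotKerEquivRange ≪≫ₗ LinearEquiv.ofEq _ _ h.linearMap_ker_eq.symm
  · exact hP.of_linearEquiv (hP.submodule hC (LinearMap.range g)) g.quotKerEquivRange.symm

end IsSerreClass

open Abelian

/-- Postcomposition with an isomorphism on `Ext`. -/
def extCongrRight (X : ModuleCat.{0} R) {Y Z : ModuleCat.{0} R} (e : Y ≅ Z) (n : ℕ) :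
    Ext X Y n ≃ₗ[R] Ext X Z n :=
  (extEquiv X Y n).symm ≪≫ₗ (((_root_.Ext R (ModuleCat.{0} R) n).obj
    (Opposite.op X)).mapIso e).toLinearEquiv ≪≫ₗ extEquiv X Z n

/-- Every homomorphism from `R / a` takes values in the `a`-torsion. -/
def homIdealTorsionEquiv (a : Ideal R) (M : Type) [AddCommGroup M] [Module R M] :
    ((R ⧸ a) →ₗ[R] idealTorsion a M) ≃ₗ[R] ((R ⧸ a) →ₗ[R] M) :=
  LinearEquiv.ofBijective (LinearMap.llcomp R (R ⧸ a) _ M (idealTorsion a M).subtype)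
    ⟨fun _ _ h ↦ LinearMap.ext fun x ↦ Subtype.ext (LinearMap.congr_fun h x),
      fun f ↦ ⟨f.codRestrict _ fun x ↦ apply_mem_idealTorsion (n := 1) (pow_one a).le f x,
        rfl⟩⟩

namespace IsExtLimit

lemma congr {a : Ideal R} {M : ModuleCat.{0} R} {i : ℕ} {L L' : Type} [AddCommGroup L]
    [Module R L] [AddCommGroup L'] [Module R L'] (hL : IsExtLimit a M i L) (e : L ≃ₗ[R] L') :
    IsExtLimit a M i L' := by
  obtain ⟨ι, hι, hs, hz⟩ := hL
  refine ⟨fun n ↦ e.toLinearMap ∘ₗ ι n, fun n m h x ↦ congrArg e (hι n m h x), fun y ↦ ?_,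
    fun n x hx ↦ hz n x (e.map_eq_zero_iff.mp hx)⟩
  obtain ⟨n, x, hx⟩ := hs (e.symm y)
  exact ⟨n, x, (congrArg e hx).trans (e.apply_symm_apply y)⟩

lemma quotient_idealTorsion [IsNoetherianRing R] {a : Ideal R} {i : ℕ}
    {M L : Type} [AddCommGroup M] [Module R M] [AddCommGroup L] [Module R L]
    (hL : IsExtLimit a (ModuleCat.of R M) (i + 1) L) :
    IsExtLimit a (ModuleCat.of R (M ⧸ idealTorsion a M)) (i + 1) L := by
  have h := isExtLimit_locCoh a (M ⧸ idealTorsion a M) (i + 1)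
  obtain ⟨e⟩ := h.of_quotient_idealTorsion.nonempty_linearEquiv hL
  exact h.congr e

end IsExtLimit

lemma exists_shortExact_torsionFree [IsNoetherianRing R] (a : Ideal R) (M : Type)
    [AddCommGroup M] [Module R M] :
    ∃ (E : Type) (_ : AddCommGroup E) (_ : Module R E) (f : (M ⧸ idealTorsion a M) →ₗ[R] E),
      Module.Injective R E ∧ idealTorsion a E = ⊥ ∧ Function.Injective f := by
  obtain ⟨I, _, _, f, _, hf⟩ := exists_injective_embedding R M
  refine ⟨I ⧸ idealTorsion a I, inferInstance, inferInstance,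
    Submodule.mapQ _ _ f fun x hx ↦ map_mem_idealTorsion f hx,
    injective_quotient_idealTorsion a I, idealTorsion_quotient_idealTorsion a I, ?_⟩
  refine (injective_iff_map_eq_zero _).mpr fun x hx ↦ ?_
  obtain ⟨x, rfl⟩ := Submodule.mkQ_surjective _ x
  exact (Submodule.Quotient.mk_eq_zero _).mpr
    (mem_idealTorsion_of_injective f hf ((Submodule.Quotient.mk_eq_zero _).mp hx))

lemma IsSerreClass.hom_of_isExtLimit [IsNoetherianRing R] {a : Ideal R} {P : ModuleCat R → Prop}
    (hP : IsSerreClass R P) (s : ℕ) :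
    ∀ (M : Type) [AddCommGroup M] [Module R M] (L : ℕ → ModuleCat R),
      (∀ i, IsExtLimit a (ModuleCat.of R M) i (L i)) →
      P (ModuleCat.of R (Ext (ModuleCat.of R (R ⧸ a)) (ModuleCat.of R M) s)) →
      (∀ i < s, ∀ j, P (ModuleCat.of R (Ext (ModuleCat.of R (R ⧸ a)) (L i) j))) →
      P (ModuleCat.of R ((R ⧸ a) →ₗ[R] L s)) := by
  induction s with
  | zero =>
    intro M _ _ L hL h1 _
    obtain ⟨e⟩ := (isExtLimit_idealTorsion a M).nonempty_linearEquiv (hL 0)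
    exact hP.of_linearEquiv h1 (Ext.linearEquiv₀ ≪≫ₗ ModuleCat.homLinearEquiv ≪≫ₗ
      (homIdealTorsionEquiv a M).symm ≪≫ₗ LinearEquiv.congrRight e)
  | succ s ih =>
    intro M _ _ L hL h1 h2
    obtain ⟨e⟩ := (hL 0).nonempty_linearEquiv (isExtLimit_idealTorsion a M)
    have hΓ (j) : P (ModuleCat.of R (Ext (ModuleCat.of R (R ⧸ a))
        (ModuleCat.of R (idealTorsion a M)) j)) :=
      hP.of_linearEquiv (h2 0 s.succ_pos j) (extCongrRight _ e.toModuleIso j)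
    have hS := shortExact_subtype_mkQ (idealTorsion a M)
    have hM : P (ModuleCat.of R (Ext (ModuleCat.of R (R ⧸ a))
        (ModuleCat.of R (M ⧸ idealTorsion a M)) (s + 1))) := by
      refine hP.of_exact h1 (hΓ (s + 2))
        ((Ext.mk₀ (ModuleCat.ofHom (idealTorsion a M).mkQ)).postcompOfLinear R _ (add_zero _))
        (hS.extClass.postcompOfLinear R _ rfl) fun x ↦ ⟨fun hx ↦ ?_, ?_⟩
      · exact Ext.covariant_sequence_exact₃ _ hS x rfl hx
      · rintro ⟨y, rfl⟩
        refine (Ext.comp_assoc _ _ _ (add_zero _) (zero_add 1) (by lia)).trans ?_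
        exact (congrArg (fun t ↦ y.comp t rfl) hS.comp_extClass).trans (Ext.comp_zero _ _ _ _ _)
    obtain ⟨E, _, _, f, _, hE, hf⟩ := exists_shortExact_torsionFree a M
    have hS' := shortExact_mkQ_range f hf
    refine ih (E ⧸ LinearMap.range f) (fun i ↦ L (i + 1)) (fun i ↦ ?_) ?_
      fun i hi j ↦ h2 (i + 1) (Nat.succ_lt_succ hi) j
    · exact IsExtLimit.of_shortExact hS'
        (fun n ↦ ext_eq_zero_of_idealTorsion_eq_bot (b := a ^ n) le_rfl E hE)
        (hL (i + 1)).quotient_idealTorsion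
    · exact hP.of_linearEquiv hM (extClassEquiv hS' _
        (ext_eq_zero_of_idealTorsion_eq_bot (n := 1) (pow_one a).le E hE) s).symm

end

/-- If `Ext_R^s(R/a, M)` lies in a Serre class `P` and `Ext_R^j(R/a, H^i_a(M))` lies in `P`
for all `i < s` and all `j`, then `Hom_R(R/a, H^s_a(M))` lies in `P`. -/
theorem serreClass_hom_locCoh (R : Type) [CommRing R] [IsNoetherianRing R] (a : Ideal R)
    (P : ModuleCat R → Prop) (hP : IsSerreClass R P) (s : ℕ)
    (M : Type) [AddCommGroup M] [Module R M]
    (h1 : P (((Ext R (ModuleCat R) s).obj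
        (Opposite.op (ModuleCat.of R (R ⧸ a)))).obj (ModuleCat.of R M)))
    (h2 : ∀ i < s, ∀ j : ℕ, P (((Ext R (ModuleCat R) j).obj
        (Opposite.op (ModuleCat.of R (R ⧸ a)))).obj (locCoh R a i M))) :
    P (ModuleCat.of R ((R ⧸ a) →ₗ[R] ↥(locCoh R a s M))) := by
  exact hP.hom_of_isExtLimit s M (fun i ↦ locCoh R a i M) (isExtLimit_locCoh a M)
    (hP.of_linearEquiv (A := ↑(((Ext R (ModuleCat R) s).obj
      (Opposite.op (ModuleCat.of R (R ⧸ a)))).obj (ModuleCat.of R M))) h1 (extEquiv _ _ s))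
    fun i hi j ↦ hP.of_linearEquiv (A := ↑(((Ext R (ModuleCat R) j).obj
      (Opposite.op (ModuleCat.of R (R ⧸ a)))).obj (locCoh R a i M))) (h2 i hi j)
      (extEquiv _ _ j)
end
end

section
/- Let R be a commutative Noetherian ring, a an ideal of R, S a Serre subcategory of the category of R-modules, s a non-negative integer, and M an R-module such that Ext_R^{s+1}(R/a, M) belongs to S. If Ext_R^j(R/a, H^i_a(M)) belongs to S for all i < s and all j ≥ 0, then Ext_R^1(R/a, H^s_a(M)) belongs to S. -/
open CategoryTheory

noncomputable section

namespace CategoryTheory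

open Limits

section LeftDerived

universe v v' u u'

variable {C : Type u} [Category.{v} C] [Abelian C]
  {D : Type u'} [Category.{v'} D] [Abelian D]
  {F G H : C ⥤ D} [F.Additive] [G.Additive] [H.Additive]

/-- The complex obtained by applying an additive functor to a projective resolution. -/
abbrev ProjectiveResolution.mapComplex {X : C} (P : ProjectiveResolution X) (F : C ⥤ D)
    [F.Additive] : ChainComplex D ℕ :=
  (F.mapHomologicalComplex _).obj P.complex

/-- The morphism of complexes obtained by applying a natural transformation to a projective
resolution. -/
abbrev ProjectiveResolution.mapComplexNatTrans {X : C} (P : ProjectiveResolution X) (α : F ⟶ G) :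
    P.mapComplex F ⟶ P.mapComplex G :=
  (NatTrans.mapHomologicalComplex α _).app P.complex

/-- Two composable natural transformations between additive functors form a short exact
sequence on each projective object. -/
structure NatTrans.ShortExactOnProjectives (α : F ⟶ G) (β : G ⟶ H) : Prop where
  zero : α ≫ β = 0
  shortExact (X : C) [Projective X] :
    (ShortComplex.mk (α.app X) (β.app X) (NatTrans.congr_app zero X)).ShortExact

namespace NatTrans.ShortExactOnProjectives

variable {α : F ⟶ G} {β : G ⟶ H} (h : NatTrans.ShortExactOnProjectives α β)

/-- The short complex of chain complexes obtained by applying two composable natural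
transformations to a projective resolution. -/
abbrev shortComplex {X : C} (P : ProjectiveResolution X) : ShortComplex (ChainComplex D ℕ) :=
  ShortComplex.mk (P.mapComplexNatTrans α) (P.mapComplexNatTrans β) (by
    ext i
    exact NatTrans.congr_app h.zero (P.complex.X i))

lemma shortExact_shortComplex {X : C} (P : ProjectiveResolution X) :
    (h.shortComplex P).ShortExact :=
  HomologicalComplex.shortExact_of_degreewise_shortExact _
    fun i ↦ h.shortExact (P.complex.X i)

/-- The connecting morphism in homology computed with a given projective resolution. -/
def homologyδ {X : C} (P : ProjectiveResolution X) (n : ℕ) :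
    (P.mapComplex H).homology (n + 1) ⟶ (P.mapComplex F).homology n :=
  (h.shortExact_shortComplex P).δ (n + 1) n (by simp)

lemma homologyδ_naturality {X Y : C} (P : ProjectiveResolution X) (Q : ProjectiveResolution Y)
    (φ : P.complex ⟶ Q.complex) (n : ℕ) :
    h.homologyδ P n ≫ HomologicalComplex.homologyMap ((F.mapHomologicalComplex _).map φ) n =
      HomologicalComplex.homologyMap ((H.mapHomologicalComplex _).map φ) (n + 1) ≫
        h.homologyδ Q n :=
  HomologicalComplex.HomologySequence.δ_naturality
    (ShortComplex.Hom.mk (S₁ := h.shortComplex P) (S₂ := h.shortComplex Q)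
      ((F.mapHomologicalComplex _).map φ) ((G.mapHomologicalComplex _).map φ)
      ((H.mapHomologicalComplex _).map φ) ((NatTrans.mapHomologicalComplex α _).naturality φ)
      ((NatTrans.mapHomologicalComplex β _).naturality φ))
    (h.shortExact_shortComplex P) (h.shortExact_shortComplex Q) (n + 1) n (by simp)

end NatTrans.ShortExactOnProjectives

variable [HasProjectiveResolutions C]

/-- Left derived functors are computed by the homology of a projective resolution. -/
def ProjectiveResolution.leftDerivedIso {X : C} (P : ProjectiveResolution X) (F : C ⥤ D)
    [F.Additive] (n : ℕ) : (F.leftDerived n).obj X ≅ (P.mapComplex F).homology n :=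
  P.isoLeftDerivedObj F n

lemma ProjectiveResolution.leftDerivedIso_hom_naturality {X Y : C} (f : X ⟶ Y)
    (P : ProjectiveResolution X) (Q : ProjectiveResolution Y) (φ : P.complex ⟶ Q.complex)
    (comm : φ.f 0 ≫ Q.π.f 0 = P.π.f 0 ≫ f) (F : C ⥤ D) [F.Additive] (n : ℕ) :
    (F.leftDerived n).map f ≫ (Q.leftDerivedIso F n).hom =
      (P.leftDerivedIso F n).hom ≫
        HomologicalComplex.homologyMap ((F.mapHomologicalComplex _).map φ) n :=
  ProjectiveResolution.isoLeftDerivedObj_hom_naturality f P Q φ comm F n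

lemma NatTrans.leftDerived_app_leftDerivedIso_hom (α : F ⟶ G) {X : C}
    (P : ProjectiveResolution X) (n : ℕ) :
    (NatTrans.leftDerived α n).app X ≫ (P.leftDerivedIso G n).hom =
      (P.leftDerivedIso F n).hom ≫ HomologicalComplex.homologyMap (P.mapComplexNatTrans α) n := by
  have := P.leftDerived_app_eq α n
  rw [← Iso.eq_comp_inv, Category.assoc]
  exact this

lemma ProjectiveResolution.fromLeftDerivedZero_app_eq {X : C} (P : ProjectiveResolution X)
    (F : C ⥤ D) [F.Additive] :
    F.fromLeftDerivedZero.app X = (P.leftDerivedIso F 0).hom ≫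
      (P.mapComplex F).homologyι 0 ≫ P.fromLeftDerivedZero' F :=
  P.fromLeftDerivedZero_eq F

lemma NatTrans.leftDerived_zero_comp_fromLeftDerivedZero (α : F ⟶ G) (X : C) :
    (NatTrans.leftDerived α 0).app X ≫ G.fromLeftDerivedZero.app X =
      F.fromLeftDerivedZero.app X ≫ α.app X := by
  let P := projectiveResolution X
  have key : HomologicalComplex.opcyclesMap (P.mapComplexNatTrans α) 0 ≫
      P.fromLeftDerivedZero' G = P.fromLeftDerivedZero' F ≫ α.app X := by
    rw [← cancel_epi (HomologicalComplex.pOpcycles _ _)]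
    simp only [ProjectiveResolution.pOpcycles_comp_fromLeftDerivedZero'_assoc,
      HomologicalComplex.p_opcyclesMap_assoc,
      ProjectiveResolution.pOpcycles_comp_fromLeftDerivedZero']
    exact (α.naturality _).symm
  rw [P.fromLeftDerivedZero_app_eq, P.fromLeftDerivedZero_app_eq,
    ← Category.assoc, NatTrans.leftDerived_app_leftDerivedIso_hom, Category.assoc, Category.assoc,
    Category.assoc,
    HomologicalComplex.homologyι_naturality_assoc, key]

namespace NatTrans.ShortExactOnProjectives

variable {α : F ⟶ G} {β : G ⟶ H} (h : NatTrans.ShortExactOnProjectives α β)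

/-- The connecting morphism between left derived functors. -/
def leftDerivedδ (n : ℕ) : H.leftDerived (n + 1) ⟶ F.leftDerived n where
  app X := ((projectiveResolution X).leftDerivedIso H (n + 1)).hom ≫
    h.homologyδ (projectiveResolution X) n ≫ ((projectiveResolution X).leftDerivedIso F n).inv
  naturality X Y f := by
    let P := projectiveResolution X
    let Q := projectiveResolution Y
    let φ : P.complex ⟶ Q.complex := ProjectiveResolution.lift f P Q
    have comm : φ.f 0 ≫ Q.π.f 0 = P.π.f 0 ≫ f := ProjectiveResolution.lift_commutes_zero f P Q
    change (H.leftDerived (n + 1)).map f ≫ (Q.leftDerivedIso H (n + 1)).hom ≫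
        h.homologyδ Q n ≫ (Q.leftDerivedIso F n).inv =
      ((P.leftDerivedIso H (n + 1)).hom ≫ h.homologyδ P n ≫ (P.leftDerivedIso F n).inv) ≫
        (F.leftDerived n).map f
    rw [← cancel_mono (Q.leftDerivedIso F n).hom]
    simp only [Category.assoc, Iso.inv_hom_id, Category.comp_id,
      ProjectiveResolution.leftDerivedIso_hom_naturality f P Q φ comm F n,
      h.homologyδ_naturality P Q φ, Iso.inv_hom_id_assoc]
    rw [← Category.assoc, ProjectiveResolution.leftDerivedIso_hom_naturality f P Q φ comm H (n + 1),
      Category.assoc]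

lemma leftDerivedδ_app_comp_hom (n : ℕ) (X : C) :
    (h.leftDerivedδ n).app X ≫ ((projectiveResolution X).leftDerivedIso F n).hom =
      ((projectiveResolution X).leftDerivedIso H (n + 1)).hom ≫
        h.homologyδ (projectiveResolution X) n := by
  simp [leftDerivedδ]

include h in
lemma leftDerived_comp (n : ℕ) (X : C) :
    (NatTrans.leftDerived α n).app X ≫ (NatTrans.leftDerived β n).app X = 0 := by
  rw [← NatTrans.comp_app, ← NatTrans.leftDerived_comp, h.zero,
    ← cancel_mono ((projectiveResolution X).leftDerivedIso H n).hom,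
    NatTrans.leftDerived_app_leftDerivedIso_hom, zero_comp]
  convert comp_zero
  rw [← HomologicalComplex.homologyMap_zero]
  rfl

lemma leftDerived_comp_δ (n : ℕ) (X : C) :
    (NatTrans.leftDerived β (n + 1)).app X ≫ (h.leftDerivedδ n).app X = 0 := by
  rw [← cancel_mono ((projectiveResolution X).leftDerivedIso F n).hom, Category.assoc,
    h.leftDerivedδ_app_comp_hom,
    ← Category.assoc, NatTrans.leftDerived_app_leftDerivedIso_hom, Category.assoc, zero_comp]
  convert comp_zero
  exact (h.shortExact_shortComplex _).comp_δ (n + 1) n (by simp)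

lemma δ_comp_leftDerived (n : ℕ) (X : C) :
    (h.leftDerivedδ n).app X ≫ (NatTrans.leftDerived α n).app X = 0 := by
  rw [← cancel_mono ((projectiveResolution X).leftDerivedIso G n).hom, Category.assoc,
    NatTrans.leftDerived_app_leftDerivedIso_hom, ← Category.assoc,
    h.leftDerivedδ_app_comp_hom, zero_comp, Category.assoc]
  convert comp_zero
  exact (h.shortExact_shortComplex _).δ_comp (n + 1) n (by simp)

lemma leftDerived_exact₂ (n : ℕ) (X : C) :
    (ShortComplex.mk _ _ (h.leftDerived_comp n X)).Exact := by
  let P := projectiveResolution X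
  refine (ShortComplex.exact_iff_of_iso ?_).2 ((h.shortExact_shortComplex P).homology_exact₂ n)
  exact ShortComplex.isoMk (P.leftDerivedIso F n) (P.leftDerivedIso G n) (P.leftDerivedIso H n)
    (NatTrans.leftDerived_app_leftDerivedIso_hom α P n).symm
    (NatTrans.leftDerived_app_leftDerivedIso_hom β P n).symm

lemma leftDerived_exact₃ (n : ℕ) (X : C) :
    (ShortComplex.mk _ _ (h.leftDerived_comp_δ n X)).Exact := by
  let P := projectiveResolution X
  refine (ShortComplex.exact_iff_of_iso ?_).2
    ((h.shortExact_shortComplex P).homology_exact₃ (n + 1) n (by simp))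
  exact ShortComplex.isoMk (P.leftDerivedIso G (n + 1)) (P.leftDerivedIso H (n + 1))
    (P.leftDerivedIso F n)
    (NatTrans.leftDerived_app_leftDerivedIso_hom β P (n + 1)).symm
    (h.leftDerivedδ_app_comp_hom n X).symm

lemma leftDerived_exact₁ (n : ℕ) (X : C) :
    (ShortComplex.mk _ _ (h.δ_comp_leftDerived n X)).Exact := by
  let P := projectiveResolution X
  refine (ShortComplex.exact_iff_of_iso ?_).2
    ((h.shortExact_shortComplex P).homology_exact₁ (n + 1) n (by simp))
  exact ShortComplex.isoMk (P.leftDerivedIso H (n + 1)) (P.leftDerivedIso F n)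
    (P.leftDerivedIso G n)
    (h.leftDerivedδ_app_comp_hom n X).symm
    (NatTrans.leftDerived_app_leftDerivedIso_hom α P n).symm

end NatTrans.ShortExactOnProjectives

end LeftDerived

section Ext

universe v u

variable (R : Type v) [CommRing R] {C : Type u} [Category.{v} C] [Abelian C] [Linear R C]

instance preservesFiniteColimits_linearYoneda_obj_rightOp (Y : C) :
    PreservesFiniteColimits ((linearYoneda R C).obj Y).rightOp := by
  have : PreservesLimits ((linearYoneda R C).obj Y ⋙ forget (ModuleCat.{v} R)) :=
    inferInstanceAs (PreservesLimits (yoneda.obj Y))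
  have : PreservesLimits ((linearYoneda R C).obj Y) :=
    preservesLimits_of_reflects_of_preserves _ (forget (ModuleCat.{v} R))
  exact preservesFiniteColimits_rightOp _

/-- The natural transformation on contravariant Hom functors induced by a morphism, in the
opposite category of modules. -/
abbrev linearYonedaRightOp {Y Y' : C} (f : Y ⟶ Y') :
    ((linearYoneda R C).obj Y').rightOp ⟶ ((linearYoneda R C).obj Y).rightOp :=
  NatTrans.rightOp ((linearYoneda R C).map f)

variable {S : ShortComplex C} (hS : S.ShortExact)

include hS in
lemma shortExactOnProjectives_linearYonedaRightOp :
    NatTrans.ShortExactOnProjectives (linearYonedaRightOp R S.g) (linearYonedaRightOp R S.f) where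
  zero := by
    ext X
    apply Quiver.Hom.unop_inj
    ext (x : X ⟶ S.X₁)
    exact (Category.assoc _ _ _).trans ((congrArg (x ≫ ·) S.zero).trans comp_zero)
  shortExact X _ := by
    have := hS.mono_f
    have := hS.epi_g
    let T : ShortComplex (ModuleCat.{v} R) := ShortComplex.mk
      (((linearYoneda R C).map S.f).app (Opposite.op X))
      (((linearYoneda R C).map S.g).app (Opposite.op X)) (by
        ext (x : X ⟶ S.X₁)
        exact (Category.assoc _ _ _).trans ((congrArg (x ≫ ·) S.zero).trans comp_zero))
    have hT : T.ShortExact := by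
      refine { exact := ?_, mono_f := ?_, epi_g := ?_ }
      · rw [ShortComplex.moduleCat_exact_iff]
        intro (x : X ⟶ S.X₂) (hx : x ≫ S.g = 0)
        exact ⟨hS.exact.lift x hx, hS.exact.lift_f x hx⟩
      · rw [ModuleCat.mono_iff_injective]
        intro (x : X ⟶ S.X₁) (y : X ⟶ S.X₁) (hxy : x ≫ S.f = y ≫ S.f)
        exact (cancel_mono S.f).1 hxy
      · rw [ModuleCat.epi_iff_surjective]
        intro (x : X ⟶ S.X₃)
        exact ⟨Projective.factorThru x S.g, Projective.factorThru_comp x S.g⟩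
    exact hT.op

variable [EnoughProjectives C]

/-- The connecting morphism of `Ext` in the second variable, natural in the first variable. -/
def extδ (n : ℕ) : (Ext R C n).flip.obj S.X₃ ⟶ (Ext R C (n + 1)).flip.obj S.X₁ :=
  NatTrans.leftOp ((shortExactOnProjectives_linearYonedaRightOp R hS).leftDerivedδ n)

variable (X : Cᵒᵖ) (n : ℕ)

include hS in
lemma ext_map_comp_map : ((Ext R C n).obj X).map S.f ≫ ((Ext R C n).obj X).map S.g = 0 :=
  congrArg Quiver.Hom.unop
    ((shortExactOnProjectives_linearYonedaRightOp R hS).leftDerived_comp n X.unop)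

lemma ext_exact₂ : (ShortComplex.mk _ _ (ext_map_comp_map R hS X n)).Exact :=
  ((shortExactOnProjectives_linearYonedaRightOp R hS).leftDerived_exact₂ n X.unop).unop

lemma ext_map_comp_δ : ((Ext R C n).obj X).map S.g ≫ (extδ R hS n).app X = 0 :=
  congrArg Quiver.Hom.unop
    ((shortExactOnProjectives_linearYonedaRightOp R hS).δ_comp_leftDerived n X.unop)

lemma ext_δ_comp_map : (extδ R hS n).app X ≫ ((Ext R C (n + 1)).obj X).map S.f = 0 :=
  congrArg Quiver.Hom.unop
    ((shortExactOnProjectives_linearYonedaRightOp R hS).leftDerived_comp_δ n X.unop)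

lemma ext_exact₃ : (ShortComplex.mk _ _ (ext_map_comp_δ R hS X n)).Exact :=
  ((shortExactOnProjectives_linearYonedaRightOp R hS).leftDerived_exact₁ n X.unop).unop

lemma ext_exact₁ : (ShortComplex.mk _ _ (ext_δ_comp_map R hS X n)).Exact :=
  ((shortExactOnProjectives_linearYonedaRightOp R hS).leftDerived_exact₃ n X.unop).unop

lemma isZero_Ext_succ_of_injective (X Y : C) [Injective Y] (n : ℕ) :
    IsZero (((Ext R C (n + 1)).obj (Opposite.op X)).obj Y) := by
  let P := projectiveResolution X
  let F := ((linearYoneda R C).obj Y).rightOp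
  suffices IsZero ((P.mapComplex F).homology (n + 1)) from
    (this.of_iso (P.leftDerivedIso F (n + 1))).unop
  rw [← HomologicalComplex.exactAt_iff_isZero_homology,
    HomologicalComplex.exactAt_iff' _ (n + 2) (n + 1) n (by simp) (by simp)]
  have hP := P.exact_succ n
  refine ShortComplex.Exact.op (S := ShortComplex.mk
    (((linearYoneda R C).obj Y).map (P.complex.d (n + 1) n).op)
    (((linearYoneda R C).obj Y).map (P.complex.d (n + 2) (n + 1)).op) ?_) ?_
  · rw [← Functor.map_comp, ← op_comp, HomologicalComplex.d_comp_d, op_zero, Functor.map_zero]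
  · rw [ShortComplex.moduleCat_exact_iff]
    intro (x : P.complex.X (n + 1) ⟶ Y) (hx : P.complex.d (n + 2) (n + 1) ≫ x = 0)
    exact ⟨hP.descToInjective x hx, hP.comp_descToInjective x hx⟩

/-- `Ext` in degree zero is `Hom`. -/
def extZeroIso (X : C) (Y : C) :
    ((Ext R C 0).obj (Opposite.op X)).obj Y ≅ ((linearYoneda R C).obj Y).obj (Opposite.op X) :=
  (((linearYoneda R C).obj Y).rightOp.leftDerivedZeroIsoSelf.app X).unop.symm

lemma extZeroIso_hom_naturality_left {X X' : C} (f : X ⟶ X') (Y : C) :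
    ((Ext R C 0).map f.op).app Y ≫ (extZeroIso R X Y).hom =
      (extZeroIso R X' Y).hom ≫ ((linearYoneda R C).obj Y).map f.op := by
  rw [← Iso.inv_comp_eq, ← Category.assoc, ← Iso.eq_comp_inv]
  exact congrArg Quiver.Hom.unop
    (((linearYoneda R C).obj Y).rightOp.fromLeftDerivedZero.naturality f)

lemma extZeroIso_hom_naturality_right (X : C) {Y Y' : C} (f : Y ⟶ Y') :
    ((Ext R C 0).obj (Opposite.op X)).map f ≫ (extZeroIso R X Y').hom =
      (extZeroIso R X Y).hom ≫ ((linearYoneda R C).map f).app (Opposite.op X) := by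
  rw [← Iso.inv_comp_eq, ← Category.assoc, ← Iso.eq_comp_inv]
  exact congrArg Quiver.Hom.unop
    (NatTrans.leftDerived_zero_comp_fromLeftDerivedZero (linearYonedaRightOp R f) X)

end Ext

end CategoryTheory

section Torsion

variable {R M : Type*} [CommRing R] [AddCommGroup M] [Module R M] (a : Ideal R)

lemma Submodule.FG.exists_pow_smul_eq_zero {N : Submodule R M} (hN : N.FG)
    (h : ∀ x ∈ N, ∃ t, ∀ r ∈ a ^ t, r • x = 0) : ∃ t, ∀ x ∈ N, ∀ r ∈ a ^ t, r • x = 0 := by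
  obtain ⟨s, rfl⟩ := hN
  choose! t ht using h
  refine ⟨s.sup t, fun x hx r hr ↦ ?_⟩
  induction hx using Submodule.span_induction with
  | mem x hx =>
    exact ht x (Submodule.subset_span hx) r (Ideal.pow_le_pow_right (Finset.le_sup hx) hr)
  | zero => exact smul_zero r
  | add x y _ _ hx hy => rw [smul_add, hx, hy, add_zero]
  | smul c x _ hx => rw [smul_comm, hx, smul_zero]

variable {a} in
lemma exists_pow_smul_eq_zero_of_forall_smul (ha : a.FG) {x : M}
    (h : ∀ p ∈ a, ∃ t, ∀ r ∈ a ^ t, r • p • x = 0) : ∃ t, ∀ r ∈ a ^ t, r • x = 0 := by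
  obtain ⟨t, ht⟩ := (Submodule.FG.map
    (LinearMap.toSpanSingleton R M x) ha).exists_pow_smul_eq_zero a
    (by rintro _ ⟨p, hp, rfl⟩; exact h p hp)
  refine ⟨t + 1, fun r hr ↦ ?_⟩
  rw [pow_succ] at hr
  induction hr using Submodule.mul_induction_on' with
  | mem_mul_mem r hr p hp => rw [mul_smul]; exact ht _ ⟨p, hp, rfl⟩ r hr
  | add x _ y _ hx hy => rw [add_smul, hx, hy, add_zero]

end Torsion

namespace localCohomology

open CategoryTheory Limits Opposite

universe u

section Colimit

variable {R : Type u} [CommRing R] (a : Ideal R) (n : ℕ)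

/-- The direct system of the modules `Ext^n(R/a^t, M)`. -/
abbrev extDiagram (M : ModuleCat.{u} R) : (ℕᵒᵖ)ᵒᵖ ⥤ ModuleCat.{u} R :=
  (ringModIdeals (idealPowersDiagram a)).op ⋙ (Ext R (ModuleCat.{u} R) n).flip.obj M

/-- The tautological cocone on `extDiagram`, with point the local cohomology module. -/
def cocone (M : ModuleCat.{u} R) : Cocone (extDiagram a n M) :=
  ((evaluation _ _).obj M).mapCocone (colimit.cocone (diagram (idealPowersDiagram a) n))

/-- Local cohomology is the colimit of `extDiagram`. -/
def isColimitCocone (M : ModuleCat.{u} R) : IsColimit (cocone a n M) :=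
  isColimitOfPreserves ((evaluation _ _).obj M)
    (colimit.isColimit (diagram (idealPowersDiagram a) n))

/-- The structure map from `Ext^n(R/a^t, M)`. -/
def ι (M : ModuleCat.{u} R) (t : ℕ) :
    ((Ext R (ModuleCat.{u} R) n).obj (op (ModuleCat.of R (R ⧸ a ^ t)))).obj M ⟶
      (localCohomology a n).obj M :=
  (cocone a n M).ι.app (op (op t))

lemma ι_naturality {M N : ModuleCat.{u} R} (f : M ⟶ N) (t : ℕ) :
    ι a n M t ≫ (localCohomology a n).map f =
      ((Ext R (ModuleCat.{u} R) n).obj (op (ModuleCat.of R (R ⧸ a ^ t)))).map f ≫ ι a n N t :=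
  ((colimit.cocone (diagram (idealPowersDiagram a) n)).ι.app (op (op t))).naturality f |>.symm

instance : PreservesFilteredColimitsOfSize.{0, 0} (forget (ModuleCat.{u} R)) :=
  preservesFilteredColimitsOfSize_shrink.{0, u, 0, u} _

variable {a n} in
lemma exists_ι_eq {M : ModuleCat.{u} R} (x : (localCohomology a n).obj M) :
    ∃ t y, ι a n M t y = x := by
  obtain ⟨t, y, hy⟩ := Concrete.isColimit_exists_rep _ (isColimitCocone a n M) x
  exact ⟨t.unop.unop, y, hy⟩

/-- The projection `R/a^t ⟶ R/a^t'`. -/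
def proj {t t' : ℕ} (h : t' ≤ t) :
    ModuleCat.of R (R ⧸ a ^ t) ⟶ ModuleCat.of R (R ⧸ a ^ t') :=
  (ringModIdeals (idealPowersDiagram a)).map (homOfLE h).op

lemma exists_of_ι_eq_zero {M : ModuleCat.{u} R} {t : ℕ}
    (y : ((Ext R (ModuleCat.{u} R) n).obj (op (ModuleCat.of R (R ⧸ a ^ t)))).obj M)
    (hy : ι a n M t y = 0) :
    ∃ (t' : ℕ) (h : t ≤ t'), ((Ext R (ModuleCat.{u} R) n).map (proj a h).op).app M y = 0 := by
  obtain ⟨t', f, f', h⟩ := Concrete.isColimit_exists_of_rep_eq _ (isColimitCocone a n M)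
    (i := op (op t)) (j := op (op t)) y 0 (hy.trans (map_zero (ι a n M t).hom).symm)
  refine ⟨t'.unop.unop, leOfHom f.unop.unop, h.trans (map_zero ((extDiagram a n M).map f').hom)⟩

@[simp]
lemma ι_map_proj (M : ModuleCat.{u} R) {t t' : ℕ} (h : t ≤ t') :
    ((Ext R (ModuleCat.{u} R) n).map (proj a h).op).app M ≫ ι a n M t' = ι a n M t :=
  (cocone a n M).w (homOfLE h).op.op

section LongExactSequence

variable {S : ShortComplex (ModuleCat.{u} R)} (hS : S.ShortExact)

/-- The connecting morphism of local cohomology. -/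
def δ : (localCohomology a n).obj S.X₃ ⟶ (localCohomology a (n + 1)).obj S.X₁ :=
  (isColimitCocone a n S.X₃).map (cocone a (n + 1) S.X₁)
    (Functor.whiskerLeft (ringModIdeals (idealPowersDiagram a)).op (extδ R hS n))

lemma ι_δ (t : ℕ) : ι a n S.X₃ t ≫ δ a n hS =
    (extδ R hS n).app (op (ModuleCat.of R (R ⧸ a ^ t))) ≫ ι a (n + 1) S.X₁ t :=
  (isColimitCocone a n S.X₃).ι_map _ _ (op (op t))

lemma exact_of_exact {n₁ n₂ n₃ : ℕ} {M₁ M₂ M₃ : ModuleCat.{u} R}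
    (f : (localCohomology a n₁).obj M₁ ⟶ (localCohomology a n₂).obj M₂)
    (g : (localCohomology a n₂).obj M₂ ⟶ (localCohomology a n₃).obj M₃)
    (φ : (Ext R (ModuleCat.{u} R) n₁).flip.obj M₁ ⟶ (Ext R (ModuleCat.{u} R) n₂).flip.obj M₂)
    (ψ : (Ext R (ModuleCat.{u} R) n₂).flip.obj M₂ ⟶ (Ext R (ModuleCat.{u} R) n₃).flip.obj M₃)
    (hf : ∀ t, ι a n₁ M₁ t ≫ f = φ.app (op (ModuleCat.of R (R ⧸ a ^ t))) ≫ ι a n₂ M₂ t)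
    (hg : ∀ t, ι a n₂ M₂ t ≫ g = ψ.app (op (ModuleCat.of R (R ⧸ a ^ t))) ≫ ι a n₃ M₃ t)
    (w : ∀ X, φ.app X ≫ ψ.app X = 0) (h : ∀ X, (ShortComplex.mk _ _ (w X)).Exact) :
    ∃ w' : f ≫ g = 0, (ShortComplex.mk f g w').Exact := by
  have hf' t (y) : f (ι a n₁ M₁ t y) = _ := ConcreteCategory.congr_hom (hf t) y
  have hg' t (y) : g (ι a n₂ M₂ t y) = _ := ConcreteCategory.congr_hom (hg t) y
  refine ⟨?_, ?_⟩
  · ext x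
    obtain ⟨t, y, rfl⟩ := exists_ι_eq x
    refine (congrArg g.hom (hf' t y)).trans ((hg' t _).trans ?_)
    refine (congrArg (ι a n₃ M₃ t).hom (ConcreteCategory.congr_hom (w _) y)).trans ?_
    exact map_zero _
  · rw [ShortComplex.moduleCat_exact_iff]
    intro (x : (localCohomology a n₂).obj M₂) (hx : g x = 0)
    obtain ⟨t, y, rfl⟩ := exists_ι_eq x
    rw [hg' t y] at hx
    obtain ⟨t', ht, hy⟩ := exists_of_ι_eq_zero a n₃ _ hx
    have hy' := (ConcreteCategory.congr_hom (ψ.naturality (proj a ht).op) y).trans hy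
    obtain ⟨z, hz⟩ := (ShortComplex.moduleCat_exact_iff _).1 (h _) _ hy'
    refine ⟨ι a n₁ M₁ t' z, (hf' t' z).trans ((congrArg (ι a n₂ M₂ t').hom hz).trans ?_)⟩
    exact ConcreteCategory.congr_hom (ι_map_proj a n₂ M₂ ht) y

include hS in
lemma exact₂ : ∃ w, (ShortComplex.mk ((localCohomology a n).map S.f)
    ((localCohomology a n).map S.g) w).Exact :=
  exact_of_exact a _ _ ((Ext R (ModuleCat.{u} R) n).flip.map S.f)
    ((Ext R (ModuleCat.{u} R) n).flip.map S.g) (ι_naturality a n _) (ι_naturality a n _)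
    (fun X ↦ ext_map_comp_map R hS X n) (fun X ↦ ext_exact₂ R hS X n)

lemma exact₃ : ∃ w, (ShortComplex.mk ((localCohomology a n).map S.g) (δ a n hS) w).Exact :=
  exact_of_exact a _ _ ((Ext R (ModuleCat.{u} R) n).flip.map S.g) (extδ R hS n)
    (ι_naturality a n _) (ι_δ a n hS)
    (fun X ↦ ext_map_comp_δ R hS X n) (fun X ↦ ext_exact₃ R hS X n)

lemma exact₁ : ∃ w, (ShortComplex.mk (δ a n hS) ((localCohomology a (n + 1)).map S.f) w).Exact :=
  exact_of_exact a _ _ (extδ R hS n) ((Ext R (ModuleCat.{u} R) (n + 1)).flip.map S.f)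
    (ι_δ a n hS) (ι_naturality a _ _)
    (fun X ↦ ext_δ_comp_map R hS X n) (fun X ↦ ext_exact₁ R hS X n)

end LongExactSequence

end Colimit

variable {R : Type u} [CommRing R]

/-- Evaluation of linear maps `R/J ⟶ M` at `1`. -/
def homEval (J : Ideal R) (M : ModuleCat.{u} R) :
    ((linearYoneda R (ModuleCat.{u} R)).obj M).obj (op (ModuleCat.of R (R ⧸ J))) ⟶ M :=
  ModuleCat.ofHom (X := ModuleCat.of R (R ⧸ J) ⟶ M)
    { toFun f := f.hom (1 : R ⧸ J)
      map_add' _ _ := rfl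
      map_smul' _ _ := rfl }

/-- Evaluation of elements of `Ext^0(R/J, M)`, regarded as linear maps, at `1`. -/
def extZeroEval (J : Ideal R) (M : ModuleCat.{u} R) :
    ((Ext R (ModuleCat.{u} R) 0).obj (op (ModuleCat.of R (R ⧸ J)))).obj M ⟶ M :=
  (extZeroIso R (ModuleCat.of R (R ⧸ J)) M).hom ≫ homEval J M

lemma extZeroEval_injective (J : Ideal R) (M : ModuleCat.{u} R) :
    Function.Injective (extZeroEval J M) := by
  refine Function.Injective.comp (g := fun f : ModuleCat.of R (R ⧸ J) ⟶ M ↦ f.hom (1 : R ⧸ J)) ?_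
    ((ModuleCat.mono_iff_injective (extZeroIso R (ModuleCat.of R (R ⧸ J)) M).hom).1 inferInstance)
  intro f g h
  ext : 1
  exact Submodule.linearMap_qext _ (LinearMap.ext_ring h)

lemma mem_range_extZeroEval_iff (J : Ideal R) (M : ModuleCat.{u} R) (x : M) :
    x ∈ Set.range (extZeroEval J M) ↔ ∀ r ∈ J, r • x = 0 := by
  constructor
  · rintro ⟨y, rfl⟩ r hr
    let f : ModuleCat.of R (R ⧸ J) ⟶ M := (extZeroIso R (ModuleCat.of R (R ⧸ J)) M).hom y
    change r • f.hom (1 : R ⧸ J) = 0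
    rw [← map_smul]
    have : r • (1 : R ⧸ J) = 0 := by
      rw [Algebra.smul_def, mul_one]
      exact Ideal.Quotient.eq_zero_iff_mem.2 hr
    exact (congrArg f.hom this).trans (map_zero _)
  · intro h
    let f : ModuleCat.of R (R ⧸ J) ⟶ M :=
      ModuleCat.ofHom (J.liftQ (LinearMap.toSpanSingleton R M x) h)
    refine ⟨(extZeroIso R (ModuleCat.of R (R ⧸ J)) M).inv f, ?_⟩
    refine (congrArg (fun g : ModuleCat.of R (R ⧸ J) ⟶ M ↦ g.hom (1 : R ⧸ J))
      (ConcreteCategory.congr_hom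
        (extZeroIso R (ModuleCat.of R (R ⧸ J)) M).inv_hom_id f)).trans ?_
    exact (Submodule.liftQ_apply _ _ _).trans (one_smul R x)

lemma extZeroEval_naturality (J : Ideal R) {M N : ModuleCat.{u} R} (f : M ⟶ N) :
    ((Ext R (ModuleCat.{u} R) 0).obj (op (ModuleCat.of R (R ⧸ J)))).map f ≫ extZeroEval J N =
      extZeroEval J M ≫ f := by
  rw [extZeroEval, ← Category.assoc, extZeroIso_hom_naturality_right, Category.assoc]
  rfl

lemma proj_extZeroEval (a : Ideal R) {t t' : ℕ} (h : t ≤ t') (M : ModuleCat.{u} R) :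
    ((Ext R (ModuleCat.{u} R) 0).map (proj a h).op).app M ≫ extZeroEval (a ^ t') M =
      extZeroEval (a ^ t) M := by
  rw [extZeroEval, ← Category.assoc, extZeroIso_hom_naturality_left, Category.assoc]
  rfl

variable (a : Ideal R)

/-- The inclusion of the zeroth local cohomology module. -/
def ε (M : ModuleCat.{u} R) : (localCohomology a 0).obj M ⟶ M :=
  (isColimitCocone a 0 M).desc
    { pt := M
      ι :=
        { app t := extZeroEval (a ^ t.unop.unop) M
          naturality _ _ f := (proj_extZeroEval a (leOfHom f.unop.unop) M).trans
            (Category.comp_id _).symm } }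

lemma ι_ε (M : ModuleCat.{u} R) (t : ℕ) : ι a 0 M t ≫ ε a M = extZeroEval (a ^ t) M :=
  (isColimitCocone a 0 M).fac _ (op (op t))

lemma ε_naturality {M N : ModuleCat.{u} R} (f : M ⟶ N) :
    (localCohomology a 0).map f ≫ ε a N = ε a M ≫ f := by
  ext x
  obtain ⟨t, y, rfl⟩ := exists_ι_eq x
  refine ConcreteCategory.congr_hom (f := ι a 0 M t ≫ (localCohomology a 0).map f ≫ ε a N)
    (g := ι a 0 M t ≫ ε a M ≫ f) ?_ y
  rw [← Category.assoc, ι_naturality, Category.assoc, ι_ε, extZeroEval_naturality,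
    ← ι_ε, Category.assoc]

instance (M : ModuleCat.{u} R) : Mono (ε a M) := by
  rw [ModuleCat.mono_iff_injective]
  refine (injective_iff_map_eq_zero (ε a M).hom).2 fun x hx ↦ ?_
  obtain ⟨t, y, rfl⟩ := exists_ι_eq x
  have hy : extZeroEval (a ^ t) M y = 0 := (ConcreteCategory.congr_hom (ι_ε a M t) y).symm.trans hx
  have : y = 0 := extZeroEval_injective _ _ (hy.trans (map_zero (extZeroEval (a ^ t) M).hom).symm)
  exact (congrArg (ι a 0 M t).hom this).trans (map_zero _)

lemma mem_range_ε_iff (M : ModuleCat.{u} R) (x : M) :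
    x ∈ Set.range (ε a M) ↔ ∃ t, ∀ r ∈ a ^ t, r • x = 0 := by
  simp_rw [← mem_range_extZeroEval_iff, ← ι_ε]
  constructor
  · rintro ⟨y, rfl⟩
    obtain ⟨t, z, rfl⟩ := exists_ι_eq y
    exact ⟨t, z, rfl⟩
  · rintro ⟨t, z, rfl⟩
    exact ⟨ι a 0 M t z, rfl⟩

lemma mono_map_zero {M N : ModuleCat.{u} R} (f : M ⟶ N) [Mono f] :
    Mono ((localCohomology a 0).map f) :=
  have : Mono ((localCohomology a 0).map f ≫ ε a N) := by
    rw [ε_naturality]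
    infer_instance
  mono_of_mono _ (ε a N)

lemma exists_pow_smul_eq_zero {M : ModuleCat.{u} R} (x : (localCohomology a 0).obj M) :
    ∃ t, ∀ r ∈ a ^ t, r • x = 0 := by
  obtain ⟨t, ht⟩ := (mem_range_ε_iff a M (ε a M x)).1 ⟨x, rfl⟩
  refine ⟨t, fun r hr ↦ (ModuleCat.mono_iff_injective (ε a M)).1 inferInstance ?_⟩
  exact ((ε a M).hom.map_smul r x).trans ((ht r hr).trans (map_zero (ε a M).hom).symm)

instance injective_localCohomology_zero [IsNoetherianRing R] (I : ModuleCat.{u} R) [Injective I] :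
    Injective ((localCohomology a 0).obj I) := by
  have : Module.Injective R ((localCohomology a 0).obj I) := by
    refine Module.Baer.injective fun J f ↦ ?_
    obtain ⟨t, ht⟩ := (Submodule.FG.map f (IsNoetherian.noetherian (⊤ : Submodule R J))
      ).exists_pow_smul_eq_zero a fun x _ ↦ exists_pow_smul_eq_zero a x
    obtain ⟨k, hk⟩ := a.exists_pow_inf_eq_pow_smul J
    let q : J →ₗ[R] R ⧸ a ^ (k + t) := (a ^ (k + t)).mkQ ∘ₗ J.subtype
    let e : (localCohomology a 0).obj I →ₗ[R] I := (ε a I).hom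
    have hf : LinearMap.ker q ≤ LinearMap.ker (e ∘ₗ f) := by
      intro x hx
      have h1 : (x : R) ∈ a ^ (k + t) • (⊤ : Submodule R R) ⊓ J :=
        ⟨by simpa using (Submodule.Quotient.mk_eq_zero _).1 hx, x.2⟩
      rw [hk (k + t) (by omega), Nat.add_sub_cancel_left] at h1
      have h2 : (x : R) ∈ (a ^ t • (⊤ : Submodule R J)).map J.subtype := by
        rw [Submodule.map_smul'', Submodule.map_top, Submodule.range_subtype]
        exact Submodule.smul_mono le_rfl inf_le_right h1
      obtain ⟨y, hy, hyx⟩ := h2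
      obtain rfl : y = x := Subtype.ext hyx
      have : f y = 0 := by
        clear hyx hx h1
        induction hy using Submodule.smul_induction_on' with
        | smul r hr z _ => rw [map_smul]; exact ht _ ⟨z, trivial, rfl⟩ r hr
        | add z _ w _ hz hw => rw [map_add, hz, hw, add_zero]
      exact (congrArg e this).trans (map_zero e)
    have := Module.injective_module_of_injective_object R I
    obtain ⟨h, hh⟩ := Module.Injective.out ((LinearMap.ker q).liftQ q le_rfl)
      (LinearMap.ker_eq_bot.1 (Submodule.ker_liftQ_eq_bot' _ q rfl))
      ((LinearMap.ker q).liftQ (e ∘ₗ f) hf)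
    obtain ⟨y, hy⟩ := (mem_range_ε_iff a I (h (1 : R ⧸ a ^ (k + t)))).2 ⟨k + t, fun r hr ↦ by
      rw [← map_smul, Algebra.smul_def, mul_one, Ideal.Quotient.algebraMap_eq,
        Ideal.Quotient.eq_zero_iff_mem.2 hr, map_zero]⟩
    refine ⟨LinearMap.toSpanSingleton R _ y, fun x hx ↦ ?_⟩
    refine (ModuleCat.mono_iff_injective (ε a I)).1 inferInstance ?_
    change e (x • y) = e (f ⟨x, hx⟩)
    have h3 : h (q ⟨x, hx⟩) = e (f ⟨x, hx⟩) := hh (Submodule.Quotient.mk ⟨x, hx⟩)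
    rw [← h3, map_smul, show e y = _ from hy, ← map_smul]
    congr 1
    rw [Algebra.smul_def, mul_one]
    rfl
  exact Module.injective_object_of_injective_module R _

lemma isZero_succ_of_injective (n : ℕ) (I : ModuleCat.{u} R) [Injective I] :
    IsZero ((localCohomology a (n + 1)).obj I) := by
  rw [ModuleCat.isZero_iff_subsingleton]
  refine subsingleton_of_forall_eq 0 fun x ↦ ?_
  obtain ⟨t, y, rfl⟩ := exists_ι_eq x
  have := ModuleCat.subsingleton_of_isZero
    (isZero_Ext_succ_of_injective R (ModuleCat.of R (R ⧸ a ^ t)) I n)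
  rw [Subsingleton.elim y 0]
  exact map_zero _

variable {S : ShortComplex (ModuleCat.{u} R)} (hS : S.ShortExact)

section Injective

variable [Injective S.X₂]

/-- Dimension shifting for local cohomology. -/
def isoSucc (n : ℕ) : (localCohomology a (n + 1)).obj S.X₃ ≅ (localCohomology a (n + 2)).obj S.X₁ :=
  have : Mono (δ a (n + 1) hS) := by
    obtain ⟨w, h⟩ := exact₃ a (n + 1) hS
    exact h.mono_g ((isZero_succ_of_injective a n S.X₂).eq_of_src _ _)
  have : Epi (δ a (n + 1) hS) := by
    obtain ⟨w, h⟩ := exact₁ a (n + 1) hS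
    exact h.epi_f ((isZero_succ_of_injective a (n + 1) S.X₂).eq_of_tgt _ _)
  have : IsIso (δ a (n + 1) hS) := isIso_of_mono_of_epi _
  asIso (δ a (n + 1) hS)

lemma shortExact_kernel_δ :
    (ShortComplex.mk (kernel.ι (δ a 0 hS)) (δ a 0 hS) (kernel.condition _)).ShortExact where
  exact := ShortComplex.exact_kernel _
  mono_f := inferInstance
  epi_g := by
    obtain ⟨w, h⟩ := exact₁ a 0 hS
    exact h.epi_f ((isZero_succ_of_injective a 0 S.X₂).eq_of_tgt _ _)

end Injective

include hS in
lemma map_comp_δ : (localCohomology a 0).map S.g ≫ δ a 0 hS = 0 := (exact₃ a 0 hS).1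

lemma shortExact_kernelLift_δ : ∃ w, (ShortComplex.mk ((localCohomology a 0).map S.f)
    (kernel.lift (δ a 0 hS) ((localCohomology a 0).map S.g) (map_comp_δ a hS)) w).ShortExact := by
  obtain ⟨w, h⟩ := exact₂ a 0 hS
  have := hS.mono_f
  have w' : (localCohomology a 0).map S.f ≫
      kernel.lift (δ a 0 hS) ((localCohomology a 0).map S.g) (map_comp_δ a hS) = 0 := by
    rw [← cancel_mono (kernel.ι _), Category.assoc, kernel.lift_ι, w, zero_comp]
  refine ⟨w', { exact := ?_, mono_f := mono_map_zero a S.f, epi_g := ?_ }⟩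
  · exact (ShortComplex.exact_iff_of_epi_of_isIso_of_mono
      { τ₁ := 𝟙 _, τ₂ := 𝟙 _, τ₃ := kernel.ι (δ a 0 hS), comm₁₂ := by simp, comm₂₃ := by simp } :
      (ShortComplex.mk _ _ w').Exact ↔ (ShortComplex.mk _ _ w).Exact).2 h
  · exact (exact₃ a 0 hS).2.epi_kernelLift

lemma isZero_ext_zero_cokernel_ε (ha : a.FG) (M : ModuleCat.{u} R) :
    IsZero (((Ext R (ModuleCat.{u} R) 0).obj (op (ModuleCat.of R (R ⧸ a)))).obj
      (cokernel (ε a M))) := by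
  rw [ModuleCat.isZero_iff_subsingleton]
  refine subsingleton_of_forall_eq 0 fun y ↦ extZeroEval_injective _ _ ?_
  refine Eq.trans ?_ (map_zero (extZeroEval a _).hom).symm
  have hy := (mem_range_extZeroEval_iff a _ _).1 ⟨y, rfl⟩
  obtain ⟨x, hx⟩ := (ModuleCat.epi_iff_surjective (cokernel.π (ε a M))).1 inferInstance
    (extZeroEval a _ y)
  have key (x : M) (h : cokernel.π (ε a M) x = 0) : x ∈ Set.range (ε a M) :=
    (ShortComplex.moduleCat_exact_iff _).1 (ShortComplex.exact_cokernel (ε a M)) x h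
  rw [← hx] at hy ⊢
  obtain ⟨z, rfl⟩ := (mem_range_ε_iff a M x).2 <|
    exists_pow_smul_eq_zero_of_forall_smul ha fun p hp ↦
      (mem_range_ε_iff a M _).1 (key _ (((cokernel.π (ε a M)).hom.map_smul p x).trans (hy p hp)))
  exact ConcreteCategory.congr_hom (cokernel.condition (ε a M)) z

lemma mono_ext_one_map_ε (ha : a.FG) (M : ModuleCat.{u} R) :
    Mono (((Ext R (ModuleCat.{u} R) 1).obj (op (ModuleCat.of R (R ⧸ a)))).map (ε a M)) := by
  have hS : (ShortComplex.mk (ε a M) (cokernel.π _) (cokernel.condition _)).ShortExact :=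
    { exact := ShortComplex.exact_cokernel _
      mono_f := inferInstanceAs (Mono (ε a M))
      epi_g := inferInstanceAs (Epi (cokernel.π (ε a M))) }
  exact (ext_exact₁ R hS _ 0).mono_g
    ((isZero_ext_zero_cokernel_ε a ha M).eq_of_src _ _)

lemma prop_ext_one [IsNoetherianRing R] (P : ObjectProperty (ModuleCat.{u} R)) [P.IsSerreClass]
    (s : ℕ) (M : ModuleCat.{u} R) (H : ℕ → ModuleCat.{u} R) {S : ShortComplex (ModuleCat.{u} R)}
    (hS : S.ShortExact) (e₂ : S.X₂ ≅ (localCohomology a 0).obj M) (e₃ : S.X₃ ≅ H 0)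
    (e : ∀ i, H (i + 1) ≅ (localCohomology a (i + 1)).obj M)
    (h₁ : ∀ j, P (((Ext R (ModuleCat.{u} R) (j + 1)).obj
      (op (ModuleCat.of R (R ⧸ a)))).obj S.X₁))
    (hH : ∀ i < s, ∀ j, P (((Ext R (ModuleCat.{u} R) j).obj
      (op (ModuleCat.of R (R ⧸ a)))).obj (H i)))
    (hM : P (((Ext R (ModuleCat.{u} R) (s + 1)).obj (op (ModuleCat.of R (R ⧸ a)))).obj M)) :
    P (((Ext R (ModuleCat.{u} R) 1).obj (op (ModuleCat.of R (R ⧸ a)))).obj (H s)) := by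
  induction s generalizing M H S with
  | zero =>
    have := mono_ext_one_map_ε a (IsNoetherian.noetherian a) M
    have h₂ := P.prop_of_mono
      (((Ext R (ModuleCat.{u} R) 1).obj (op (ModuleCat.of R (R ⧸ a)))).map (ε a M)) hM
    exact P.prop_of_iso (Functor.mapIso _ e₃) (P.prop_X₂_of_exact (ext_exact₃ R hS _ 1)
      (P.prop_of_iso (Functor.mapIso _ e₂.symm) h₂) (h₁ 1))
  | succ s ih =>
    have h₂ (j : ℕ) : P (((Ext R (ModuleCat.{u} R) (j + 1)).obj
        (op (ModuleCat.of R (R ⧸ a)))).obj ((localCohomology a 0).obj M)) :=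
      P.prop_of_iso (Functor.mapIso _ e₂) (P.prop_X₂_of_exact (ext_exact₂ R hS _ (j + 1)) (h₁ j)
        (P.prop_of_iso (Functor.mapIso _ e₃.symm) (hH 0 (by omega) (j + 1))))
    let T := ShortComplex.mk (Injective.ι M) (cokernel.π _) (cokernel.condition _)
    have hT : T.ShortExact :=
      { exact := ShortComplex.exact_cokernel _
        mono_f := inferInstanceAs (Mono (Injective.ι M))
        epi_g := inferInstanceAs (Epi (cokernel.π (Injective.ι M))) }
    have : Injective T.X₂ := inferInstanceAs (Injective (Injective.under M))
    obtain ⟨_, hK⟩ := shortExact_kernelLift_δ a hT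
    refine ih T.X₃ (fun i ↦ H (i + 1)) (shortExact_kernel_δ a hT) (Iso.refl _) (e 0).symm
      (fun i ↦ e (i + 1) ≪≫ (isoSucc a hT i).symm) (fun j ↦ ?_) (fun i hi ↦ hH _ (by omega)) ?_
    · exact P.prop_X₂_of_exact (ext_exact₃ R hK _ (j + 1))
        (P.prop_of_isZero (isZero_Ext_succ_of_injective R _ ((localCohomology a 0).obj T.X₂) j))
        (h₂ (j + 1))
    · exact P.prop_X₂_of_exact (ext_exact₃ R hT _ (s + 1))
        (P.prop_of_isZero (isZero_Ext_succ_of_injective R _ T.X₂ s)) hM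

end localCohomology

open scoped ZeroObject

lemma CategoryTheory.ShortComplex.shortExact_zero_id {C : Type*} [Category* C] [Abelian C]
    (M : C) : (ShortComplex.mk (0 : 0 ⟶ M) (𝟙 M) Limits.zero_comp).ShortExact where
  exact := (ShortComplex.exact_iff_mono _ rfl).2 inferInstance
  mono_f := inferInstance
  epi_g := inferInstance

lemma IsSerreClass.objectProperty {R : Type} [CommRing R] {P : ModuleCat R → Prop}
    (hP : IsSerreClass R P) {M : ModuleCat R} (hM : P M) :
    ObjectProperty.IsSerreClass (C := ModuleCat R) P where
  exists_zero := ⟨0, Limits.isZero_zero _, ((hP _ (ShortComplex.shortExact_zero_id M)).1 hM).1⟩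
  prop_of_mono f _ h :=
    ((hP _ { exact := ShortComplex.exact_cokernel f
             mono_f := inferInstanceAs (Mono f)
             epi_g := inferInstanceAs (Epi (Limits.cokernel.π f)) }).1 h).1
  prop_of_epi f _ h :=
    ((hP _ { exact := ShortComplex.exact_kernel f
             mono_f := inferInstanceAs (Mono (Limits.kernel.ι f))
             epi_g := inferInstanceAs (Epi f) }).1 h).2
  prop_X₂_of_shortExact hS h₁ h₃ := (hP _ hS).2 ⟨h₁, h₃⟩

/-- If `Ext_R^{s+1}(R/a, M)` lies in a Serre class `P` and `Ext_R^j(R/a, H^i_a(M))` lies in `P`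
for all `i < s` and all `j`, then `Ext_R^1(R/a, H^s_a(M))` lies in `P`. -/
theorem serreClass_ext_one_locCoh (R : Type) [CommRing R] [IsNoetherianRing R] (a : Ideal R)
    (P : ModuleCat R → Prop) (hP : IsSerreClass R P) (s : ℕ)
    (M : Type) [AddCommGroup M] [Module R M]
    (h1 : P (((Ext R (ModuleCat R) (s + 1)).obj
        (Opposite.op (ModuleCat.of R (R ⧸ a)))).obj (ModuleCat.of R M)))
    (h2 : ∀ i < s, ∀ j : ℕ, P (((Ext R (ModuleCat R) j).obj
        (Opposite.op (ModuleCat.of R (R ⧸ a)))).obj (locCoh R a i M))) :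
    P (((Ext R (ModuleCat R) 1).obj
        (Opposite.op (ModuleCat.of R (R ⧸ a)))).obj (locCoh R a s M)) := by
  have := hP.objectProperty h1
  exact localCohomology.prop_ext_one a P s (ModuleCat.of R M) (fun i ↦ locCoh R a i M)
    (ShortComplex.shortExact_zero_id _) (Iso.refl _) (Iso.refl _) (fun _ ↦ Iso.refl _)
    (fun j ↦ ObjectProperty.prop_of_isZero P (isZero_Ext_succ_of_injective R _ 0 j)) h2 h1
end
end
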